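/- Let d ≥ 1, 2 < p ≤ ∞ and 1/p < r < 1/2 (with 1/∞ := 0). There is a constant C (depending only on d, p, r) such that for all m ≥ 2 the Kolmogorov numbers of the embedding of the Hölder–Nikolskii space of mixed smoothness into the uniform norm satisfy d_m(I : H^r_p(𝕋^d) → L_∞(𝕋^d)) ≤ C m^{−r} (log m)^{d−1+r}. -/

import Mathlib

open MeasureTheory Real
open scoped ENNReal ComplexConjugate Classical

noncomputable section

instance : Fact (0 < 2 * π) := ⟨by positivity⟩

/-- The `d`-dimensional torus `[0, 2π]^d`. -/
abbrev Torus (d : ℕ) := Fin d → AddCircle (2 * π)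

/-- The mixed first order difference operator `Δ_h^e = ∏_{i ∈ e} Δ_{h_i, i}`, where
`Δ_{h,i} g = g(· + h eᵢ) - g(·)` is the first order difference in the `i`-th variable:
explicitly, `Δ_h^e f (x) = ∑_{u ⊆ e} (-1)^{|e| - |u|} f(x + ∑_{i ∈ u} h_i eᵢ)`. -/
def mixedDiff {d : ℕ} (e : Finset (Fin d)) (h : Fin d → ℝ) (f : Torus d → ℂ) :
    Torus d → ℂ := fun x =>
  ∑ u ∈ e.powerset, (-1 : ℂ) ^ (e.card - u.card) *
    f (x + fun j => if j ∈ u then ((h j : ℝ) : AddCircle (2 * π)) else 0)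

/-- The quantity `(∏_{i ∈ e} |h_i|^{-r}) ‖Δ_h^e f‖_q`. -/
def holderTerm (d : ℕ) (r : ℝ) (q : ℝ≥0∞) (f : Torus d → ℂ) (e : Finset (Fin d))
    (h : Fin d → ℝ) : ℝ :=
  (∏ i ∈ e, |h i| ^ (-r)) * (eLpNorm (mixedDiff e h f) q volume).toReal

/-- The admissible increments `h ∈ (0, 2π)^d`. -/
def Increments (d : ℕ) : Set (Fin d → ℝ) := {h | ∀ j, h j ∈ Set.Ioo 0 (2 * π)}

/-- The Hölder–Nikolskii space `H^r_p(𝕋^d)` of mixed smoothness: all `f ∈ L_p(𝕋^d)` with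
finite norm `∑_{e ⊆ {1,…,d}} sup_{h ∈ (0,2π)^d} (∏_{i ∈ e} |h_i|^{-r}) ‖Δ_h^e f‖_p`,
realized (for `r > 1/p`, via the embedding into `L_∞`) as a subset of `L_∞(𝕋^d)`. -/
def HolderSpace (d : ℕ) (r : ℝ) (q : ℝ≥0∞) : Type :=
  {f : Lp ℂ ∞ (volume : Measure (Torus d)) //
    ∀ e : Finset (Fin d),
      BddAbove ((fun h => holderTerm d r q (f : Torus d → ℂ) e h) '' Increments d)}

noncomputable instance (d : ℕ) (r : ℝ) (q : ℝ≥0∞) : Norm (HolderSpace d r q) :=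
  ⟨fun f => ∑ e : Finset (Fin d),
    sSup ((fun h => holderTerm d r q (f.1 : Torus d → ℂ) e h) '' Increments d)⟩

/-- Kolmogorov numbers. -/
noncomputable def dK {A B : Type*} [Norm A] [NormedAddCommGroup B] [NormedSpace ℂ B]
    (T : A → B) (m : ℕ) : ℝ :=
  ⨅ L : {L : Submodule ℂ B // FiniteDimensional ℂ L ∧ Module.finrank ℂ L < m},
    ⨆ a : {a : A // ‖a‖ ≤ 1}, ⨅ b : L.1, ‖T a.1 - (b : B)‖

/-- The sign `±1` attached to a Boolean. -/
def boolSign (b : Bool) : ℝ := if b then 1 else -1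

/-- The signed sum `∑ ± zᵢ` determined by a choice of signs. -/
def signSum {n : ℕ} (z : Fin n → ℝ) (ε : Fin n → Bool) : ℝ := ∑ i, boolSign (ε i) * z i

lemma sum_signs_succ {n : ℕ} (F : (Fin (n + 1) → Bool) → ℝ) :
    ∑ ε, F ε = ∑ ε : Fin n → Bool, (F (Fin.cons true ε) + F (Fin.cons false ε)) := by
  rw [← (Fin.consEquiv (fun _ : Fin (n + 1) => Bool)).sum_comp, Fintype.sum_prod_type]
  simp [Finset.sum_add_distrib, Fin.consEquiv]

lemma signSum_cons {n : ℕ} (z : Fin (n + 1) → ℝ) (b : Bool) (ε : Fin n → Bool) :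
    signSum z (Fin.cons b ε) = boolSign b * z 0 + signSum (fun i => z i.succ) ε := by
  simp [signSum, Fin.sum_univ_succ]

lemma sum_signSum_sq {n : ℕ} (z : Fin n → ℝ) (a : ℝ) :
    ∑ ε, (a + signSum z ε) ^ 2 = 2 ^ n * (a ^ 2 + ∑ i, z i ^ 2) := by
  induction n generalizing a with
  | zero => simp [signSum]
  | succ n ih =>
    rw [sum_signs_succ, Finset.sum_add_distrib]
    simp only [signSum_cons, ← add_assoc]
    rw [ih, ih, Fin.sum_univ_succ]
    simp only [boolSign]
    simp
    ring

lemma sum_signSum_pow_four_le {n : ℕ} (z : Fin n → ℝ) (a : ℝ) :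
    ∑ ε, (a + signSum z ε) ^ 4 ≤
      2 ^ n * (a ^ 4 + 6 * a ^ 2 * (∑ i, z i ^ 2) + 3 * (∑ i, z i ^ 2) ^ 2) := by
  induction n generalizing a with
  | zero => simp [signSum]
  | succ n ih =>
    rw [sum_signs_succ, Finset.sum_add_distrib]
    simp only [signSum_cons, ← add_assoc]
    refine (add_le_add (ih _ _) (ih _ _)).trans ?_
    rw [Fin.sum_univ_succ, ← mul_add, pow_succ (2 : ℝ) n, mul_assoc (2 ^ n : ℝ) 2]
    refine mul_le_mul_of_nonneg_left ?_ (show (0 : ℝ) ≤ 2 ^ n by positivity)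
    simp only [boolSign]
    simp
    nlinarith [sq_nonneg (z 0 ^ 2)]

lemma sum_exp_signSum_sq_le {n : ℕ} (z : Fin n → ℝ) {c : ℝ} (hc : 0 < c)
    (hz : 4 * c * ∑ i, z i ^ 2 ≤ 1) (a : ℝ) :
    ∑ ε, exp (c * (a + signSum z ε) ^ 2) ≤
      2 ^ n * exp (c / (1 - 2 * c * ∑ i, z i ^ 2) * a ^ 2 + 2 * c * ∑ i, z i ^ 2) := by
  induction n generalizing a with
  | zero => simp [signSum]
  | succ n ih =>
    rw [sum_signs_succ, Finset.sum_add_distrib]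
    simp only [signSum_cons, ← add_assoc]
    rw [Fin.sum_univ_succ] at hz ⊢
    set Z := ∑ i : Fin n, z i.succ ^ 2 with hZ
    set t := z 0 with ht
    have hZ0 : 0 ≤ Z := Finset.sum_nonneg fun _ _ => sq_nonneg _
    have ht0 : 0 ≤ t ^ 2 := sq_nonneg _
    have hcZ : 0 ≤ c * Z := by positivity
    have hct : 0 ≤ c * t ^ 2 := by positivity
    have hz' : 4 * c * Z ≤ 1 := by nlinarith
    refine (add_le_add (ih _ hz' _) (ih _ hz' _)).trans ?_
    rw [← mul_add, pow_succ (2 : ℝ) n, mul_assoc (2 ^ n : ℝ) 2]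
    refine mul_le_mul_of_nonneg_left ?_ (show (0 : ℝ) ≤ 2 ^ n by positivity)
    set K := c / (1 - 2 * c * Z) with hK
    have hD : 0 < 1 - 2 * c * Z := by linarith
    have hD' : 0 < 1 - 2 * c * (t ^ 2 + Z) := by linarith
    have hK0 : 0 < K := by positivity
    have hK2 : K ≤ 2 * c := by
      rw [hK, div_le_iff₀ hD]; nlinarith
    have hK' : K + 2 * K ^ 2 * t ^ 2 ≤ c / (1 - 2 * c * (t ^ 2 + Z)) := by
      rw [le_div_iff₀ hD']
      have h1 : K * (1 - 2 * c * Z) = c := by rw [hK, div_mul_cancel₀ _ hD.ne']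
      have : (K + 2 * K ^ 2 * t ^ 2) * (1 - 2 * c * (t ^ 2 + Z)) =
          (1 + 2 * K * t ^ 2) * (K * (1 - 2 * c * Z) - 2 * c * K * t ^ 2) := by ring
      rw [this, h1]
      nlinarith [mul_nonneg (mul_nonneg hc.le (sq_nonneg (K * t ^ 2))) zero_le_two]
    have hexp : exp (K * (a + boolSign true * t) ^ 2 + 2 * c * Z) +
        exp (K * (a + boolSign false * t) ^ 2 + 2 * c * Z) =
        2 * (exp (K * a ^ 2 + K * t ^ 2 + 2 * c * Z) * cosh (2 * K * a * t)) := by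
      rw [cosh_eq]
      simp only [boolSign]
      rw [mul_div_assoc', mul_add, ← exp_add, ← exp_add]
      simp only [if_true, Bool.false_eq_true, if_false]
      rw [mul_div_cancel₀ _ two_ne_zero]
      congr 2 <;> ring
    rw [hexp]
    refine mul_le_mul_of_nonneg_left ?_ zero_le_two
    refine (mul_le_mul_of_nonneg_left (cosh_le_exp_half_sq _) (exp_nonneg _)).trans ?_
    rw [← exp_add, exp_le_exp]
    nlinarith [mul_le_mul_of_nonneg_right hK' (sq_nonneg a), mul_le_mul_of_nonneg_right hK2 ht0]

lemma exp_neg_le_quadratic {x : ℝ} (hx : 0 ≤ x) : exp (-x) ≤ 1 - x + x ^ 2 / 2 := by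
  have h := Real.quadratic_le_exp_of_nonneg hx
  rw [exp_neg, inv_le_comm₀ (exp_pos _) (by nlinarith [sq_nonneg (x - 1)])]
  refine le_trans ?_ h
  rw [inv_le_iff_one_le_mul₀ (by nlinarith [sq_nonneg (x - 1)])]
  nlinarith [sq_nonneg (x ^ 2)]

lemma sum_exp_neg_signSum_sq_le {n : ℕ} (z : Fin n → ℝ) {Z : ℝ} (hZ : ∑ i, z i ^ 2 = Z)
    (hZ0 : 0 < Z) :
    ∑ ε, exp (-((signSum z ε) ^ 2 / (4 * Z))) ≤ 2 ^ n * exp (-(1 / 8)) := by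
  have h2 := sum_signSum_sq z 0
  have h4 := sum_signSum_pow_four_le z 0
  simp only [zero_add, hZ] at h2 h4
  have : ∑ ε, exp (-((signSum z ε) ^ 2 / (4 * Z))) ≤
      ∑ ε, (1 - (signSum z ε) ^ 2 * (1 / (4 * Z)) + (signSum z ε) ^ 4 * (1 / (32 * Z ^ 2))) := by
    refine Finset.sum_le_sum fun ε _ => ?_
    refine (exp_neg_le_quadratic (by positivity)).trans (le_of_eq ?_)
    field_simp
    ring
  refine this.trans ?_
  rw [Finset.sum_add_distrib, Finset.sum_sub_distrib, ← Finset.sum_mul, ← Finset.sum_mul, h2]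
  have hcard : ∑ _ε : Fin n → Bool, (1 : ℝ) = 2 ^ n := by simp
  rw [hcard]
  have h5 : (∑ ε, signSum z ε ^ 4) * (1 / (32 * Z ^ 2)) ≤ 2 ^ n * (3 / 32) := by
    refine (mul_le_mul_of_nonneg_right h4 (by positivity)).trans (le_of_eq ?_)
    field_simp
    ring
  have h6 : (2 : ℝ) ^ n * (0 ^ 2 + Z) * (1 / (4 * Z)) = 2 ^ n * (1 / 4) := by
    field_simp
    ring
  rw [h6]
  have h7 : (7 / 8 : ℝ) ≤ exp (-(1 / 8)) := by
    have := add_one_le_exp (-(1 / 8) : ℝ)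
    linarith
  nlinarith [show (0 : ℝ) < 2 ^ n by positivity]

/-- Johnson–Lindenstrauss with constant distortion: if `2|P| < exp (m / 16)`, some `m × n`
matrix distorts the squared norms of all vectors `z p`, `p ∈ P`, by at most a constant. -/
lemma exists_matrix_bounded_distortion {P : Type*} [Fintype P] {n m : ℕ} (z : P → Fin n → ℝ)
    (hP : 2 * (Fintype.card P : ℝ) < exp (m / 16)) :
    ∃ G : Fin m → Fin n → ℝ, ∀ p,
      m / 4 * ∑ i, z p i ^ 2 ≤ ∑ l, (∑ i, G l i * z p i) ^ 2 ∧
      ∑ l, (∑ i, G l i * z p i) ^ 2 ≤ 4 * m * ∑ i, z p i ^ 2 := by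
  set Z : P → ℝ := fun p => ∑ i, z p i ^ 2 with hZdef
  have hZnn : ∀ p, 0 ≤ Z p := fun p => Finset.sum_nonneg fun _ _ => sq_nonneg _
  set F : P → (Fin m → Fin n → Bool) → ℝ := fun p ω =>
    if Z p = 0 then 0 else
      exp (m / 16) * ∏ l, exp (-((signSum (z p) (ω l)) ^ 2 / (4 * Z p))) +
      exp (-m) * ∏ l, exp (1 / (4 * Z p) * (0 + signSum (z p) (ω l)) ^ 2) with hF
  have hFsum : ∀ p, ∑ ω, F p ω ≤ (2 ^ n) ^ m * (2 * exp (-(m / 16))) := by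
    intro p
    simp only [hF]
    split_ifs with h0
    · simp; positivity
    · have hpos : 0 < Z p := lt_of_le_of_ne (hZnn p) (Ne.symm h0)
      rw [Finset.sum_add_distrib, ← Finset.mul_sum, ← Finset.mul_sum,
        ← Fintype.sum_pow (fun ε => exp (-((signSum (z p) ε) ^ 2 / (4 * Z p)))),
        ← Fintype.sum_pow (fun ε => exp (1 / (4 * Z p) * (0 + signSum (z p) ε) ^ 2))]
      have hlow := pow_le_pow_left₀ (Finset.sum_nonneg fun _ _ => (exp_pos _).le)
        (sum_exp_neg_signSum_sq_le (z p) rfl hpos) m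
      have hupp := pow_le_pow_left₀ (Finset.sum_nonneg fun _ _ => (exp_pos _).le)
        (sum_exp_signSum_sq_le (z p) (c := 1 / (4 * Z p)) (by positivity)
          (by change 4 * (1 / (4 * Z p)) * Z p ≤ 1
              apply le_of_eq; field_simp) 0) m
      have e1 : 2 * (1 / (4 * Z p)) * ∑ i, z p i ^ 2 = 1 / 2 := by
        change 2 * (1 / (4 * Z p)) * Z p = 1 / 2
        field_simp; norm_num
      rw [e1] at hupp
      rw [mul_pow, ← exp_nat_mul] at hlow hupp
      have hA := mul_le_mul_of_nonneg_left hlow (exp_pos ((m : ℝ) / 16)).le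
      have hB := mul_le_mul_of_nonneg_left hupp (exp_pos (-(m : ℝ))).le
      refine (add_le_add hA hB).trans ?_
      have h3 : exp ((m : ℝ) / 16) * exp (m * -(1 / 8)) = exp (-(m / 16)) := by
        rw [← exp_add]; congr 1; ring
      have h4 : exp (-(m : ℝ)) * exp (m * (1 / (4 * Z p) / (1 - 1 / 2) * 0 ^ 2 + 1 / 2)) ≤
          exp (-(m / 16)) := by
        rw [← exp_add, exp_le_exp]
        have : (0 : ℝ) ≤ m := Nat.cast_nonneg m
        norm_num
        linarith
      calc _ = (2 ^ n) ^ m * (exp ((m : ℝ) / 16) * exp (m * -(1 / 8))) + (2 ^ n) ^ m *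
            (exp (-(m : ℝ)) * exp (m * (1 / (4 * Z p) / (1 - 1 / 2) * 0 ^ 2 + 1 / 2))) := by ring
        _ ≤ (2 ^ n) ^ m * exp (-(m / 16)) + (2 ^ n) ^ m * exp (-(m / 16)) := by
            rw [h3]; gcongr
        _ = _ := by ring
  have htot : ∑ ω, ∑ p, F p ω < ∑ _ω : Fin m → Fin n → Bool, (1 : ℝ) := by
    rw [Finset.sum_comm]
    refine (Finset.sum_le_sum fun p _ => hFsum p).trans_lt ?_
    simp only [Finset.sum_const, Finset.card_univ, nsmul_eq_mul, mul_one]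
    rw [Fintype.card_fun, Fintype.card_fun, Fintype.card_bool, Fintype.card_fin, Fintype.card_fin]
    push_cast
    have : (Fintype.card P : ℝ) * ((2 ^ n) ^ m * (2 * exp (-(m / 16)))) =
        (2 ^ n) ^ m * (2 * (Fintype.card P : ℝ) * exp (-(m / 16))) := by ring
    rw [this]
    refine mul_lt_of_lt_one_right (by positivity) ?_
    rw [exp_neg, ← div_eq_mul_inv, div_lt_one (exp_pos _)]
    exact hP
  obtain ⟨ω, -, hω⟩ := Finset.exists_lt_of_sum_lt htot
  refine ⟨fun l i => boolSign (ω l i), fun p => ?_⟩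
  have hFnn : ∀ p, 0 ≤ F p ω := fun p => by
    simp only [hF]; split_ifs <;> positivity
  have hp : F p ω < 1 :=
    (Finset.single_le_sum (fun p _ => hFnn p) (Finset.mem_univ p)).trans_lt hω
  change m / 4 * Z p ≤ ∑ l, signSum (z p) (ω l) ^ 2 ∧
    ∑ l, signSum (z p) (ω l) ^ 2 ≤ 4 * m * Z p
  by_cases h0 : Z p = 0
  · have hz0 : ∀ i, z p i = 0 := fun i => by
      have := (Finset.sum_eq_zero_iff_of_nonneg fun i _ => sq_nonneg (z p i)).1 h0 i
        (Finset.mem_univ i)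
      simpa using this
    simp [h0, signSum, hz0]
  · have hpos : 0 < Z p := lt_of_le_of_ne (hZnn p) (Ne.symm h0)
    simp only [hF, if_neg h0] at hp
    rw [← exp_sum, ← exp_sum, ← exp_add, ← exp_add, Finset.sum_neg_distrib, ← Finset.sum_div,
      ← Finset.mul_sum] at hp
    simp only [zero_add] at hp
    have e1 := (le_add_of_nonneg_right (exp_pos _).le).trans_lt hp
    have e2 := (le_add_of_nonneg_left (exp_pos _).le).trans_lt hp
    rw [exp_lt_one_iff] at e1 e2
    constructor
    · have : (m : ℝ) / 16 < (∑ l, signSum (z p) (ω l) ^ 2) / (4 * Z p) := by linarith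
      rw [lt_div_iff₀ (by positivity)] at this
      linarith
    · have : (∑ l, signSum (z p) (ω l) ^ 2) / (4 * Z p) < m := by
        rw [div_eq_inv_mul, ← one_div]; linarith
      rw [div_lt_iff₀ (by positivity)] at this
      linarith

/-- Greedy form of Maurey's empirical approximation. -/
lemma exists_empirical_approx {κ ι : Type*} [Fintype κ] [Fintype ι] (w : κ → ℝ)
    (hw : ∀ j, 0 ≤ w j) (hw1 : ∑ j, w j = 1) (u : κ → ι → ℝ) {R : ℝ}
    (hu : ∀ j, ∑ i, u j i ^ 2 ≤ R) (k : ℕ) :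
    ∃ φ : Fin k → κ, ∑ i, (∑ a, u (φ a) i - k * ∑ j, w j * u j i) ^ 2 ≤ k * R := by
  induction k with
  | zero => exact ⟨Fin.elim0, by simp⟩
  | succ k ih =>
    obtain ⟨φ, hφ⟩ := ih
    set z : ι → ℝ := fun i => ∑ j, w j * u j i with hz
    set S : ι → ℝ := fun i => ∑ a, u (φ a) i - k * z i with hS
    have havg : ∑ j, w j * ∑ i, (S i + (u j i - z i)) ^ 2 ≤ ∑ j, w j * ((k + 1) * R) := by
      have h1 : ∑ j, w j * ∑ i, (S i + (u j i - z i)) ^ 2 =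
          ∑ i, (S i ^ 2 - z i ^ 2) + ∑ j, w j * ∑ i, u j i ^ 2 := by
        simp_rw [Finset.mul_sum]
        rw [Finset.sum_comm, Finset.sum_comm (f := fun j i => w j * u j i ^ 2),
          ← Finset.sum_add_distrib]
        refine Finset.sum_congr rfl fun i _ => ?_
        have : ∀ j, w j * (S i + (u j i - z i)) ^ 2 =
            w j * (S i - z i) ^ 2 + 2 * (S i - z i) * (w j * u j i) + w j * u j i ^ 2 := by
          intro j; ring
        simp_rw [this]
        rw [Finset.sum_add_distrib, Finset.sum_add_distrib, ← Finset.sum_mul, hw1,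
          ← Finset.mul_sum]
        change 1 * (S i - z i) ^ 2 + 2 * (S i - z i) * z i + _ = _
        ring
      rw [h1, ← Finset.sum_mul, hw1, one_mul]
      have h2 : ∑ j, w j * ∑ i, u j i ^ 2 ≤ ∑ j, w j * R :=
        Finset.sum_le_sum fun j _ => mul_le_mul_of_nonneg_left (hu j) (hw j)
      rw [← Finset.sum_mul, hw1, one_mul] at h2
      have h3 : ∑ i, (S i ^ 2 - z i ^ 2) ≤ ∑ i, S i ^ 2 :=
        Finset.sum_le_sum fun i _ => by nlinarith [sq_nonneg (z i)]
      have h4 : ∑ i, S i ^ 2 ≤ k * R := hφ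
      linarith
    have hne : (Finset.univ : Finset κ).Nonempty := by
      by_contra h
      rw [Finset.not_nonempty_iff_eq_empty] at h
      rw [h] at hw1
      simp at hw1
    obtain ⟨j, hj⟩ : ∃ j, ∑ i, (S i + (u j i - z i)) ^ 2 ≤ (k + 1) * R := by
      by_contra! hcon
      have hle : ∀ j ∈ Finset.univ,
          w j * ((k + 1) * R) ≤ w j * ∑ i, (S i + (u j i - z i)) ^ 2 := fun j _ =>
        mul_le_mul_of_nonneg_left (hcon j).le (hw j)
      obtain ⟨j, -, hj⟩ : ∃ j ∈ Finset.univ, 0 < w j := by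
        by_contra! h0
        have := Finset.sum_nonpos h0
        linarith
      exact absurd havg (not_le.2 (Finset.sum_lt_sum hle
        ⟨j, Finset.mem_univ j, mul_lt_mul_of_pos_left (hcon j) hj⟩))
    refine ⟨Fin.snoc φ j, ?_⟩
    push_cast
    refine le_trans (le_of_eq (Finset.sum_congr rfl fun i _ => ?_)) hj
    rw [Fin.sum_univ_castSucc]
    simp only [Fin.snoc_castSucc, Fin.snoc_last]
    simp only [hS]
    ring

/-- Gelfand-type estimate: on the kernel of a suitable `m × n` matrix, the Euclidean norm of
`∑ x_j t_j` is controlled by the `ℓ₁`-norm of `x`. -/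
lemma exists_matrix_kernel_estimate {κ : Type*} [Fintype κ] [Nonempty κ] {n m : ℕ} (hm : 1 ≤ m)
    (t : κ → Fin n → ℝ) {σ : ℝ} (ht : ∀ j, ∑ i, t j i ^ 2 ≤ σ ^ 2) :
    ∃ G : Fin m → Fin n → ℝ, ∀ x : κ → ℝ, ∑ j, |x j| ≤ 1 →
      (∀ l, ∑ j, x j * ∑ i, G l i * t j i = 0) →
      ∑ i, (∑ j, x j * t j i) ^ 2 ≤
        (100 * σ * √(log (2 * Fintype.card κ) / m)) ^ 2 := by
  set M : ℝ := (Fintype.card κ : ℝ) with hM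
  have hM1 : 1 ≤ M := by
    rw [hM]; exact_mod_cast Fintype.card_pos
  have hlog : 0 < log (2 * M) := log_pos (by linarith)
  have hm0 : (0 : ℝ) < m := by exact_mod_cast hm
  set k : ℕ := ⌊(m : ℝ) / (64 * log (2 * M))⌋₊ with hk
  have hsq : (100 * σ * √(log (2 * M) / m)) ^ 2 = 10000 * σ ^ 2 * (log (2 * M) / m) := by
    rw [mul_pow, Real.sq_sqrt (by positivity)]; ring
  rw [hsq]
  by_cases hk0 : k = 0
  · refine ⟨0, fun x hx _ => ?_⟩
    rw [hk, Nat.floor_eq_zero, div_lt_one (by positivity)] at hk0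
    have h1 : 1 ≤ 64 * (log (2 * M) / m) := by
      rw [← mul_div_assoc, one_le_div hm0]; exact hk0.le
    have h2 : ∑ i, (∑ j, x j * t j i) ^ 2 ≤ σ ^ 2 := by
      have hcs : ∀ i, (∑ j, x j * t j i) ^ 2 ≤ ∑ j, |x j| * t j i ^ 2 := by
        intro i
        have h := Finset.sum_mul_sq_le_sq_mul_sq Finset.univ (fun j => √|x j|)
          (fun j => √|x j| * (SignType.sign (x j) * t j i))
        have e1 : ∀ j, √|x j| * (√|x j| * (SignType.sign (x j) * t j i)) = x j * t j i := by
          intro j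
          rw [← mul_assoc, Real.mul_self_sqrt (abs_nonneg _), ← mul_assoc, abs_mul_sign]
        have e2 : ∀ j, (√|x j| * (SignType.sign (x j) * t j i)) ^ 2 ≤ |x j| * t j i ^ 2 := by
          intro j
          rw [mul_pow, Real.sq_sqrt (abs_nonneg _), mul_pow]
          refine mul_le_mul_of_nonneg_left ?_ (abs_nonneg _)
          refine mul_le_of_le_one_left (sq_nonneg _) ?_
          rcases lt_trichotomy (x j) 0 with h | h | h <;> simp [h]
        simp only [e1, Real.sq_sqrt (abs_nonneg _)] at h
        refine h.trans ?_
        have hnn : 0 ≤ ∑ j, |x j| * t j i ^ 2 := Finset.sum_nonneg fun j _ => by positivity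
        calc _ ≤ 1 * ∑ j, |x j| * t j i ^ 2 :=
              mul_le_mul hx (Finset.sum_le_sum fun j _ => e2 j)
                (Finset.sum_nonneg fun _ _ => sq_nonneg _) zero_le_one
          _ = _ := one_mul _
      calc _ ≤ ∑ i, ∑ j, |x j| * t j i ^ 2 := Finset.sum_le_sum fun i _ => hcs i
        _ = ∑ j, |x j| * ∑ i, t j i ^ 2 := by
            rw [Finset.sum_comm]; simp_rw [Finset.mul_sum]
        _ ≤ ∑ j, |x j| * σ ^ 2 :=
            Finset.sum_le_sum fun j _ => mul_le_mul_of_nonneg_left (ht j) (abs_nonneg _)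
        _ ≤ σ ^ 2 := by
            rw [← Finset.sum_mul]; exact mul_le_of_le_one_left (sq_nonneg _) hx
    nlinarith [sq_nonneg σ]
  have hk1 : 1 ≤ k := Nat.one_le_iff_ne_zero.2 hk0
  have hk1' : (1 : ℝ) ≤ k := by exact_mod_cast hk1
  have hkle : (k : ℝ) * (64 * log (2 * M)) ≤ m := by
    rw [← le_div_iff₀ (by positivity)]
    exact Nat.floor_le (by positivity)
  have hkge : (m : ℝ) ≤ 2 * k * (64 * log (2 * M)) := by
    rw [← div_le_iff₀ (by positivity)]
    have := Nat.lt_floor_add_one ((m : ℝ) / (64 * log (2 * M)))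
    rw [← hk] at this
    linarith
  obtain ⟨G, hG⟩ := exists_matrix_bounded_distortion (m := m) (P := Fin k → κ × Bool)
    (fun φ i => ∑ a, boolSign (φ a).2 * t (φ a).1 i) (by
      rw [Fintype.card_fun, Fintype.card_prod, Fintype.card_bool, Fintype.card_fin]
      push_cast
      rw [← hM, mul_comm M 2]
      calc 2 * (2 * M) ^ k ≤ (2 * M) * (2 * M) ^ k := by
            gcongr; linarith
        _ = exp (log (2 * M) * (k + 1)) := by
            rw [← pow_succ', mul_comm (log _), ← Nat.cast_succ, exp_nat_mul,
              exp_log (by positivity)]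
        _ < exp (m / 16) := by
            rw [exp_lt_exp]
            nlinarith)
  refine ⟨G, fun x hx hker => ?_⟩
  have hGt : ∀ j, ∑ l, (∑ i, G l i * t j i) ^ 2 ≤ 4 * m * ∑ i, t j i ^ 2 := by
    intro j
    have h := (hG (fun _ => (j, true))).2
    simp only [boolSign, if_true, one_mul, Finset.sum_const, Finset.card_univ, Fintype.card_fin,
      nsmul_eq_mul] at h
    have e1 : ∀ l, ∑ i, G l i * (k * t j i) = k * ∑ i, G l i * t j i := fun l => by
      rw [Finset.mul_sum]; exact Finset.sum_congr rfl fun i _ => by ring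
    simp only [e1, mul_pow, ← Finset.mul_sum] at h
    have hkk : (0 : ℝ) < k ^ 2 := by positivity
    refine le_of_mul_le_mul_left (h.trans (le_of_eq ?_)) hkk
    ring
  set X := ∑ j, |x j| with hX
  rcases (Finset.sum_nonneg fun j _ => abs_nonneg (x j) : 0 ≤ X).eq_or_lt with hX0 | hX0
  · have : ∀ j, x j = 0 := fun j => by
      have := (Finset.sum_eq_zero_iff_of_nonneg fun j _ => abs_nonneg (x j)).1 hX0.symm j
        (Finset.mem_univ j)
      simpa using this
    simp only [this, zero_mul, Finset.sum_const_zero]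
    simp
    positivity
  set s : κ → Bool := fun j => decide (0 ≤ x j) with hs
  have hsx : ∀ j, |x j| * boolSign (s j) = x j := by
    intro j
    simp only [hs, boolSign]
    by_cases h : 0 ≤ x j
    · simp [h, abs_of_nonneg h]
    · simp [h, abs_of_neg (not_le.1 h)]
  have hb2 : ∀ b, boolSign b ^ 2 = 1 := by intro b; cases b <;> simp [boolSign]
  set Gt : Fin m → κ → ℝ := fun l j => ∑ i, G l i * t j i with hGtdef
  obtain ⟨φ, hφ⟩ := exists_empirical_approx (ι := Fin n ⊕ Fin m) (fun j => |x j| / X)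
    (fun j => by positivity) (by rw [← Finset.sum_div]; exact div_self hX0.ne')
    (fun j => Sum.elim (fun i => boolSign (s j) * t j i)
      (fun l => boolSign (s j) * Gt l j * (1 / (2 * √m)))) (R := 2 * σ ^ 2) (by
        intro j
        rw [Fintype.sum_sum_type]
        simp only [Sum.elim_inl, Sum.elim_inr, mul_pow, hb2, one_mul]
        rw [← Finset.sum_mul]
        have h1 := hGt j
        have h2 := ht j
        rw [div_pow, mul_pow, Real.sq_sqrt hm0.le, one_pow]
        have h3 : (∑ l, Gt l j ^ 2) * (1 / (2 ^ 2 * m)) ≤ ∑ i, t j i ^ 2 := by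
          rw [mul_one_div, div_le_iff₀ (by positivity)]
          linarith
        linarith) k
  rw [Fintype.sum_sum_type] at hφ
  simp only [Sum.elim_inl, Sum.elim_inr] at hφ
  set z : Fin n → ℝ := fun i => ∑ j, x j * t j i with hz
  have e1 : ∀ i, ∑ j, |x j| / X * (boolSign (s j) * t j i) = z i / X := by
    intro i
    simp only [hz, Finset.sum_div]
    refine Finset.sum_congr rfl fun j _ => ?_
    rw [← hsx j, abs_mul, abs_abs]
    have : |boolSign (s j)| = 1 := by cases s j <;> simp [boolSign]
    rw [this]; ring
  have e2 : ∀ l, ∑ j, |x j| / X * (boolSign (s j) * Gt l j * (1 / (2 * √m))) = 0 := by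
    intro l
    have : ∀ j, |x j| / X * (boolSign (s j) * Gt l j * (1 / (2 * √m))) =
        x j * Gt l j * (1 / (X * (2 * √m))) := by
      intro j
      nth_rw 2 [← hsx j]
      field_simp
    simp_rw [this]
    rw [← Finset.sum_mul, hker l, zero_mul]
  simp only [e1, e2, mul_zero, sub_zero] at hφ
  set S : Fin n → ℝ := fun i => ∑ a, boolSign (s (φ a)) * t (φ a) i with hS
  have e3 : ∀ l, ∑ a, boolSign (s (φ a)) * Gt l (φ a) * (1 / (2 * √m)) =
      (∑ i, G l i * S i) * (1 / (2 * √m)) := by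
    intro l
    rw [← Finset.sum_mul]
    congr 1
    simp only [hS, hGtdef, Finset.mul_sum]
    rw [Finset.sum_comm]
    exact Finset.sum_congr rfl fun i _ => Finset.sum_congr rfl fun a _ => by ring
  simp only [e3, mul_pow] at hφ
  rw [← Finset.sum_mul, div_pow, mul_pow, Real.sq_sqrt hm0.le, one_pow] at hφ
  have hlow := (hG (fun a => (φ a, s (φ a)))).1
  change m / 4 * ∑ i, S i ^ 2 ≤ ∑ l, (∑ i, G l i * S i) ^ 2 at hlow
  have hn1 : 0 ≤ ∑ i, (S i - k * (z i / X)) ^ 2 := Finset.sum_nonneg fun _ _ => sq_nonneg _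
  have hS2 : ∑ i, S i ^ 2 ≤ 32 * k * σ ^ 2 := by
    have h1 : (∑ l, (∑ i, G l i * S i) ^ 2) * (1 / (2 ^ 2 * m)) ≤ k * (2 * σ ^ 2) := by linarith
    rw [mul_one_div, div_le_iff₀ (by positivity)] at h1
    have h2 : (m : ℝ) * ∑ i, S i ^ 2 ≤ m * (32 * k * σ ^ 2) := by nlinarith
    exact le_of_mul_le_mul_left h2 hm0
  have hn2 : 0 ≤ (∑ l, (∑ i, G l i * S i) ^ 2) * (1 / (2 ^ 2 * (m : ℝ))) :=
    mul_nonneg (Finset.sum_nonneg fun _ _ => sq_nonneg _) (by positivity)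
  have hkz : ∑ i, (k * (z i / X)) ^ 2 ≤ 68 * k * σ ^ 2 := by
    calc ∑ i, (k * (z i / X)) ^ 2 ≤ ∑ i, (2 * S i ^ 2 + 2 * (S i - k * (z i / X)) ^ 2) :=
          Finset.sum_le_sum fun i _ => by nlinarith [sq_nonneg (2 * S i - k * (z i / X))]
      _ ≤ _ := by
        rw [Finset.sum_add_distrib, ← Finset.mul_sum, ← Finset.mul_sum]
        linarith
  have hzX : ∑ i, (k * (z i / X)) ^ 2 = k ^ 2 / X ^ 2 * ∑ i, z i ^ 2 := by
    rw [Finset.mul_sum]; exact Finset.sum_congr rfl fun i _ => by ring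
  rw [hzX] at hkz
  have hX1 : X ^ 2 ≤ 1 := by nlinarith
  have hzn : 0 ≤ ∑ i, z i ^ 2 := Finset.sum_nonneg fun _ _ => sq_nonneg _
  have hkz2 : (k : ℝ) ^ 2 * ∑ i, z i ^ 2 ≤ 68 * k * σ ^ 2 := by
    refine le_trans ?_ hkz
    rw [div_mul_eq_mul_div, le_div_iff₀ (by positivity)]
    exact mul_le_of_le_one_right (by positivity) hX1
  have hkz3 : (k : ℝ) * ∑ i, z i ^ 2 ≤ 68 * σ ^ 2 := by
    refine le_of_mul_le_mul_left ?_ (lt_of_lt_of_le zero_lt_one hk1')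
    linarith
  rw [← mul_div_assoc, le_div_iff₀ hm0]
  calc (∑ i, z i ^ 2) * m ≤ (∑ i, z i ^ 2) * (2 * k * (64 * log (2 * M))) := by gcongr
    _ = (k * ∑ i, z i ^ 2) * (128 * log (2 * M)) := by ring
    _ ≤ (68 * σ ^ 2) * (128 * log (2 * M)) := by gcongr
    _ ≤ _ := by nlinarith [mul_nonneg (sq_nonneg σ) hlog.le]

/-- Kolmogorov width of the image of the Euclidean ball under a matrix with rows bounded by `σ`,
in the uniform norm. -/
lemma exists_matrix_uniform_approx {κ : Type*} [Fintype κ] [Nonempty κ] {n m : ℕ} (hm : 1 ≤ m)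
    (t : κ → Fin n → ℝ) {σ : ℝ} (hσ : 0 < σ) (ht : ∀ j, ∑ i, t j i ^ 2 ≤ σ ^ 2) :
    ∃ G : Fin m → Fin n → ℝ, ∀ a : Fin n → ℝ, ∑ i, a i ^ 2 ≤ 1 →
      ∃ y : Fin m → ℝ, ∀ j, |∑ i, a i * t j i - ∑ l, y l * ∑ i, G l i * t j i| ≤
        101 * σ * √(log (2 * Fintype.card κ) / m) := by
  obtain ⟨G, hG⟩ := exists_matrix_kernel_estimate hm t ht
  have hM1 : (1 : ℝ) ≤ Fintype.card κ := by exact_mod_cast Fintype.card_pos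
  have hlog : 0 < log (2 * Fintype.card κ) := log_pos (by linarith)
  have hm0 : (0 : ℝ) < m := by exact_mod_cast hm
  set R := √(log (2 * Fintype.card κ) / m) with hR
  have hR0 : 0 < R := Real.sqrt_pos.2 (by positivity)
  refine ⟨G, fun a ha => ?_⟩
  let Φ : (Fin m → ℝ) →ₗ[ℝ] (κ → ℝ) :=
    { toFun := fun y j => ∑ l, y l * ∑ i, G l i * t j i
      map_add' := fun y y' => by
        ext j; simp [add_mul, Finset.sum_add_distrib]
      map_smul' := fun c y => by
        ext j; simp [Finset.mul_sum, mul_assoc] }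
  let L : Submodule ℝ (κ → ℝ) := LinearMap.range Φ
  have hL : IsClosed (L : Set (κ → ℝ)) := L.closed_of_finiteDimensional
  let v : κ → ℝ := fun j => ∑ i, a i * t j i
  obtain ⟨g, hg1, hgv⟩ := exists_dual_vector'' ℝ (Submodule.Quotient.mk v : (κ → ℝ) ⧸ L)
  let ψ : (κ → ℝ) →ₗ[ℝ] ℝ := (g : ((κ → ℝ) ⧸ L) →ₗ[ℝ] ℝ) ∘ₗ L.mkQ
  have hψ : ∀ u, |ψ u| ≤ ‖u‖ := fun u => by
    calc |ψ u| = ‖g (Submodule.Quotient.mk u)‖ := rfl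
      _ ≤ ‖g‖ * ‖(Submodule.Quotient.mk u : (κ → ℝ) ⧸ L)‖ := g.le_opNorm _
      _ ≤ 1 * ‖u‖ := by gcongr; exact Submodule.Quotient.norm_mk_le _ _
      _ = ‖u‖ := one_mul _
  have hψL : ∀ u ∈ L, ψ u = 0 := fun u hu => by
    have : (Submodule.Quotient.mk u : (κ → ℝ) ⧸ L) = 0 := (Submodule.Quotient.mk_eq_zero L).2 hu
    change g (Submodule.Quotient.mk u) = 0
    rw [this, map_zero]
  let x : κ → ℝ := fun j => ψ (Pi.single j 1)
  have hψx : ∀ u, ψ u = ∑ j, x j * u j := fun u => by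
    rw [LinearMap.pi_apply_eq_sum_univ ψ u]
    refine Finset.sum_congr rfl fun j _ => ?_
    rw [smul_eq_mul, mul_comm]
    congr 2
    ext i
    simp [Pi.single_apply, eq_comm]
  have hx1 : ∑ j, |x j| ≤ 1 := by
    have h := hψ (fun j => (SignType.sign (x j) : ℝ))
    rw [hψx] at h
    have e : ∀ j, x j * (SignType.sign (x j) : ℝ) = |x j| := fun j => by
      rw [mul_comm]; exact sign_mul_self (x j)
    simp only [e] at h
    refine (le_abs_self _).trans (h.trans ?_)
    refine (pi_norm_le_iff_of_nonneg zero_le_one).2 fun j => ?_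
    rcases lt_trichotomy (x j) 0 with h | h | h <;> simp [h]
  have hker : ∀ l, ∑ j, x j * ∑ i, G l i * t j i = 0 := fun l => by
    have h := hψL (Φ (Pi.single l 1)) ⟨_, rfl⟩
    rw [hψx] at h
    simpa [Φ, Pi.single_apply] using h
  have hz := hG x hx1 hker
  have hval : ψ v ≤ 100 * σ * R := by
    rw [hψx]
    have e : ∑ j, x j * v j = ∑ i, a i * ∑ j, x j * t j i := by
      simp only [v, Finset.mul_sum]
      rw [Finset.sum_comm]
      exact Finset.sum_congr rfl fun i _ => Finset.sum_congr rfl fun j _ => by ring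
    rw [e]
    refine abs_le_of_sq_le_sq' ?_ (by positivity) |>.2
    refine (Finset.sum_mul_sq_le_sq_mul_sq _ _ _).trans ?_
    calc _ ≤ 1 * (100 * σ * R) ^ 2 :=
          mul_le_mul ha hz (Finset.sum_nonneg fun _ _ => sq_nonneg _) zero_le_one
      _ = _ := one_mul _
  have hnorm : ‖(Submodule.Quotient.mk v : (κ → ℝ) ⧸ L)‖ ≤ 100 * σ * R := by
    have : (ψ v : ℝ) = ‖(Submodule.Quotient.mk v : (κ → ℝ) ⧸ L)‖ := hgv
    rw [← this]; exact hval
  obtain ⟨w, hw, hwn⟩ := Submodule.Quotient.norm_mk_lt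
    (Submodule.Quotient.mk v : (κ → ℝ) ⧸ L) (show 0 < σ * R by positivity)
  have hmem : v - w ∈ L := by
    rw [Submodule.Quotient.eq] at hw
    rw [← neg_sub]; exact L.neg_mem hw
  obtain ⟨y, hy⟩ := hmem
  refine ⟨y, fun j => ?_⟩
  have hyj : ∑ l, y l * ∑ i, G l i * t j i = v j - w j := congrFun hy j
  rw [hyj]
  change |v j - (v j - w j)| ≤ _
  rw [sub_sub_cancel]
  have := norm_le_pi_norm w j
  rw [Real.norm_eq_abs] at this
  nlinarith

/-- Complex version of `exists_matrix_uniform_approx`. -/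
lemma exists_subspace_uniform_approx {κ ι : Type*} [Fintype κ] [Nonempty κ] [Fintype ι] {m : ℕ}
    (hm : 1 ≤ m) (t : κ → ι → ℝ) {σ : ℝ} (hσ : 0 < σ) (ht : ∀ j, ∑ i, t j i ^ 2 ≤ σ ^ 2) :
    ∃ W : Submodule ℂ (κ → ℂ), Module.finrank ℂ W ≤ m ∧ ∀ a : ι → ℂ, ∑ i, ‖a i‖ ^ 2 ≤ 1 →
      ∃ b ∈ W, ∀ j, ‖∑ i, a i * (t j i : ℂ) - b j‖ ≤
        202 * σ * √(log (2 * Fintype.card κ) / m) := by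
  let e := Fintype.equivFin ι
  obtain ⟨G, hG⟩ := exists_matrix_uniform_approx hm (fun j i => t j (e.symm i)) hσ
    (fun j => by rw [e.symm.sum_comp (fun i => t j i ^ 2)]; exact ht j)
  set c : Fin m → κ → ℂ := fun l j => ((∑ i, G l i * t j (e.symm i) : ℝ) : ℂ) with hc
  refine ⟨Submodule.span ℂ (Set.range c), ?_, fun a ha => ?_⟩
  · exact (finrank_range_le_card (R := ℂ) c).trans (by simp)
  · have hre : ∑ i, (a (e.symm i)).re ^ 2 ≤ 1 := by
      rw [e.symm.sum_comp (fun i => (a i).re ^ 2)]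
      refine (Finset.sum_le_sum fun i _ => ?_).trans ha
      rw [← Complex.normSq_eq_norm_sq, Complex.normSq_apply]
      nlinarith [mul_self_nonneg (a i).im]
    have him : ∑ i, (a (e.symm i)).im ^ 2 ≤ 1 := by
      rw [e.symm.sum_comp (fun i => (a i).im ^ 2)]
      refine (Finset.sum_le_sum fun i _ => ?_).trans ha
      rw [← Complex.normSq_eq_norm_sq, Complex.normSq_apply]
      nlinarith [mul_self_nonneg (a i).re]
    obtain ⟨y, hy⟩ := hG _ hre
    obtain ⟨y', hy'⟩ := hG _ him
    refine ⟨∑ l, ((y l : ℂ) + y' l * Complex.I) • c l, Submodule.sum_mem _ fun l _ =>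
      Submodule.smul_mem _ _ (Submodule.subset_span ⟨l, rfl⟩), fun j => ?_⟩
    have hy := hy j
    have hy' := hy' j
    rw [e.symm.sum_comp (fun i => (a i).re * t j i)] at hy
    rw [e.symm.sum_comp (fun i => (a i).im * t j i)] at hy'
    have hsplit : ∑ i, a i * (t j i : ℂ) - (∑ l, ((y l : ℂ) + y' l * Complex.I) • c l) j =
        ((∑ i, (a i).re * t j i - ∑ l, y l * ∑ i, G l i * t j (e.symm i) : ℝ) : ℂ) +
        ((∑ i, (a i).im * t j i - ∑ l, y' l * ∑ i, G l i * t j (e.symm i) : ℝ) : ℂ) *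
          Complex.I := by
      apply Complex.ext <;> simp [hc, Finset.sum_apply]
    rw [hsplit]
    refine (norm_add_le _ _).trans ?_
    rw [norm_mul, Complex.norm_I, mul_one, Complex.norm_real, Complex.norm_real]
    simp only [Real.norm_eq_abs]
    linarith

/-- Uniform approximation of sums `∑ₛ hₛ ∘ πₛ` with `hₛ` in a Euclidean ball of radius `Aₛ`. -/
lemma exists_subspace_approx_sum {S X : Type*} [Fintype S] [Nonempty S] [Fintype X] [Nonempty X]
    {Q : S → Type*} [∀ s, Fintype (Q s)] (π' : ∀ s, X → Q s) {A : S → ℝ} (hA : ∀ s, 0 < A s)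
    {m : ℕ} (hm : 1 ≤ m) :
    ∃ W : Submodule ℂ (X → ℂ), Module.finrank ℂ W ≤ m ∧
      ∀ h : ∀ s, Q s → ℂ, (∀ s, ∑ k, ‖h s k‖ ^ 2 ≤ A s ^ 2) →
        ∃ b ∈ W, ∀ x, ‖∑ s, h s (π' s x) - b x‖ ≤
          202 * (∑ s, A s) * √(log (2 * Fintype.card X) / m) := by
  set B := ∑ s, A s with hB
  have hB0 : 0 < B := Finset.sum_pos (fun s _ => hA s) Finset.univ_nonempty
  have hdiv : ∀ s, 0 < √(A s * B) := fun s => Real.sqrt_pos.2 (mul_pos (hA s) hB0)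
  obtain ⟨W, hW, hWa⟩ := exists_subspace_uniform_approx (ι := Σ s, Q s) hm
    (fun x i => if π' i.1 x = i.2 then √(A i.1 * B) else 0) hB0 (fun x => by
      rw [Fintype.sum_sigma]
      simp only [ite_pow, ne_eq, OfNat.ofNat_ne_zero, not_false_eq_true, zero_pow,
        Finset.sum_ite_eq, Finset.mem_univ, if_true]
      have : ∀ s, √(A s * B) ^ 2 = A s * B := fun s =>
        Real.sq_sqrt (mul_pos (hA s) hB0).le
      simp only [this]
      rw [← Finset.sum_mul, sq])
  refine ⟨W, hW, fun h hh => ?_⟩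
  obtain ⟨b, hb, hb'⟩ := hWa (fun i => h i.1 i.2 / (√(A i.1 * B) : ℝ)) (by
    rw [Fintype.sum_sigma]
    have : ∀ s, ∑ k, ‖h s k / (√(A s * B) : ℝ)‖ ^ 2 ≤ A s / B := by
      intro s
      have e : ∀ k, ‖h s k / (√(A s * B) : ℝ)‖ ^ 2 = ‖h s k‖ ^ 2 / (A s * B) := by
        intro k
        rw [norm_div, Complex.norm_real, div_pow, Real.norm_of_nonneg (hdiv s).le,
          Real.sq_sqrt (mul_pos (hA s) hB0).le]
      simp only [e]
      rw [← Finset.sum_div, div_le_div_iff₀ (mul_pos (hA s) hB0) hB0]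
      have := mul_le_mul_of_nonneg_right (hh s) hB0.le
      nlinarith
    refine (Finset.sum_le_sum fun s _ => this s).trans ?_
    rw [← Finset.sum_div, div_self hB0.ne'])
  refine ⟨b, hb, fun x => ?_⟩
  refine le_trans (le_of_eq ?_) (hb' x)
  congr 2
  rw [Fintype.sum_sigma]
  refine Finset.sum_congr rfl fun s _ => ?_
  have hne : ((√(A s * B) : ℝ) : ℂ) ≠ 0 := by exact_mod_cast (hdiv s).ne'
  rw [Finset.sum_eq_single (π' s x)]
  · simp [div_mul_cancel₀ _ hne]
  · intro k _ hk
    simp [Ne.symm hk]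
  · simp

/-- Truncation at height `τ`. -/
lemma exists_truncation {Q : Type*} [Fintype Q] {p : ℝ} (hp : 2 < p) (v : Q → ℂ) {B τ : ℝ}
    (hτ : 0 < τ) (hv : ∑ k, ‖v k‖ ^ p ≤ B) :
    ∃ g h : Q → ℂ, (∀ k, v k = g k + h k) ∧ (∀ k, ‖g k‖ ≤ τ) ∧
      ∑ k, ‖h k‖ ^ 2 ≤ τ ^ (2 - p) * B := by
  refine ⟨fun k => if ‖v k‖ ≤ τ then v k else 0, fun k => if ‖v k‖ ≤ τ then 0 else v k,
    fun k => by dsimp only; split_ifs <;> simp, fun k => by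
      dsimp only; split_ifs with h <;> simp [h, hτ.le], ?_⟩
  refine le_trans ?_ (mul_le_mul_of_nonneg_left hv (rpow_nonneg hτ.le _))
  rw [Finset.mul_sum]
  refine Finset.sum_le_sum fun k _ => ?_
  dsimp only
  split_ifs with h
  · simp; positivity
  · rw [not_le] at h
    have hv0 : 0 < ‖v k‖ := hτ.trans h
    have : ‖v k‖ ^ 2 = ‖v k‖ ^ (2 - p) * ‖v k‖ ^ p := by
      rw [← rpow_add hv0, ← rpow_natCast]; norm_num
    rw [this]
    exact mul_le_mul_of_nonneg_right
      (rpow_le_rpow_of_nonpos hτ h.le (by linarith)) (rpow_nonneg hv0.le _)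

lemma sum_norm_sq_le_of_sum_rpow_le {Q : Type*} [Fintype Q] {p : ℝ} (hp : 2 < p) (v : Q → ℂ)
    {B τ : ℝ} (hτ : 0 < τ) (hv : ∑ k, ‖v k‖ ^ p ≤ B) :
    ∑ k, ‖v k‖ ^ 2 ≤ Fintype.card Q * τ ^ 2 + τ ^ (2 - p) * B := by
  refine le_trans ?_ (add_le_add_right (mul_le_mul_of_nonneg_left hv (rpow_nonneg hτ.le _)) _)
  rw [Finset.mul_sum, ← nsmul_eq_mul, ← Finset.card_univ, ← Finset.sum_const,
    ← Finset.sum_add_distrib]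
  refine Finset.sum_le_sum fun k _ => ?_
  rcases le_or_gt ‖v k‖ τ with h | h
  · have := pow_le_pow_left₀ (norm_nonneg _) h 2
    have : 0 ≤ τ ^ (2 - p) * ‖v k‖ ^ p := by positivity
    linarith
  · have hv0 : 0 < ‖v k‖ := hτ.trans h
    have e : ‖v k‖ ^ 2 = ‖v k‖ ^ (2 - p) * ‖v k‖ ^ p := by
      rw [← rpow_add hv0, ← rpow_natCast]; norm_num
    have := mul_le_mul_of_nonneg_right
      (rpow_le_rpow_of_nonpos hτ h.le (show 2 - p ≤ 0 by linarith)) (rpow_nonneg hv0.le p)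
    nlinarith [sq_nonneg τ]

lemma sum_level_le {d : ℕ} (N : ℕ) {F : ℕ → ℝ} (hF : ∀ n, 0 ≤ F n) :
    ∑ s : Fin (d + 1) → Fin (N + 1), F (∑ i, (s i : ℕ)) ≤
      ∑ n ∈ Finset.range ((d + 1) * N + 1), ((n : ℝ) + 1) ^ d * F n := by
  have hmaps : ∀ s ∈ (Finset.univ : Finset (Fin (d + 1) → Fin (N + 1))),
      ∑ i, (s i : ℕ) ∈ Finset.range ((d + 1) * N + 1) := fun s _ => by
    rw [Finset.mem_range, Nat.lt_succ_iff]
    refine (Finset.sum_le_sum fun i _ => Nat.lt_succ_iff.1 (s i).2).trans ?_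
    simp
  rw [← Finset.sum_fiberwise_of_maps_to hmaps]
  refine Finset.sum_le_sum fun n _ => ?_
  rw [Finset.sum_congr rfl (g := fun _ => F n) (fun s hs => by rw [(Finset.mem_filter.1 hs).2]),
    Finset.sum_const, nsmul_eq_mul]
  refine mul_le_mul_of_nonneg_right ?_ (hF n)
  have hcard : (Finset.univ.filter fun s : Fin (d + 1) → Fin (N + 1) =>
      ∑ i, (s i : ℕ) = n).card ≤ (Fintype.piFinset fun _ : Fin d => Finset.range (n + 1)).card := by
    refine Finset.card_le_card_of_injOn (fun s i => (s i.succ : ℕ)) ?_ ?_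
    · intro s hs
      simp only [Finset.coe_filter, Finset.mem_univ, true_and, Set.mem_ofPred_eq] at hs
      simp only [Finset.mem_coe, Fintype.mem_piFinset, Finset.mem_range, Nat.lt_succ_iff]
      intro i
      rw [← hs]
      exact Finset.single_le_sum (f := fun i => (s i : ℕ)) (fun _ _ => Nat.zero_le _)
        (Finset.mem_univ i.succ)
    · intro s hs s' hs' h
      simp only [Finset.coe_filter, Finset.mem_univ, true_and, Set.mem_ofPred_eq] at hs hs'
      have htail : ∀ i : Fin d, (s i.succ : ℕ) = s' i.succ := fun i => congrFun h i
      rw [Fin.sum_univ_succ] at hs hs'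
      simp only [htail] at hs
      funext i
      refine Fin.ext ?_
      refine Fin.cases ?_ htail i
      omega
  calc _ ≤ (((Fintype.piFinset fun _ : Fin d => Finset.range (n + 1)).card : ℕ) : ℝ) := by
        exact_mod_cast hcard
    _ = _ := by simp

lemma summable_poly_geometric (d : ℕ) {ρ : ℝ} (h0 : 0 < ρ) (h1 : ρ < 1) :
    Summable fun k : ℕ => ((k : ℝ) + 1) ^ d * ρ ^ k := by
  have h := (summable_nat_add_iff 1).2
    (summable_pow_mul_geometric_of_norm_lt_one (R := ℝ) d (r := ρ) (by
      rw [Real.norm_of_nonneg h0.le]; exact h1))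
  refine (h.mul_right ρ⁻¹).congr fun k => ?_
  push_cast
  rw [pow_succ]
  field_simp

lemma exists_sum_level_geometric_le (d : ℕ) {ρ : ℝ} (h0 : 0 < ρ) (h1 : ρ < 1) :
    ∃ C : ℝ, 0 < C ∧ ∀ n₁ N : ℕ,
      ∑ s : Fin (d + 1) → Fin (N + 1), ρ ^ (((∑ i, (s i : ℕ) : ℕ) : ℤ) - n₁).natAbs ≤
        C * ((n₁ : ℝ) + 1) ^ d := by
  set G : ℤ → ℝ := fun z => ((z.natAbs : ℝ) + 1) ^ d * ρ ^ z.natAbs with hG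
  have hG0 : ∀ z, 0 ≤ G z := fun z => by positivity
  have hs : Summable G := by
    refine Summable.of_nat_of_neg ?_ ?_ <;>
    simpa [hG] using summable_poly_geometric d h0 h1
  refine ⟨∑' z, G z + 1, by
    have : 0 ≤ ∑' z, G z := tsum_nonneg hG0
    linarith, fun n₁ N => ?_⟩
  refine (sum_level_le N (F := fun n => ρ ^ ((n : ℤ) - n₁).natAbs) fun n => by positivity).trans ?_
  have h2 : ∀ n : ℕ, ((n : ℝ) + 1) ^ d * ρ ^ ((n : ℤ) - n₁).natAbs ≤
      ((n₁ : ℝ) + 1) ^ d * G ((n : ℤ) - n₁) := fun n => by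
    simp only [hG]
    rw [← mul_assoc, ← mul_pow]
    refine mul_le_mul_of_nonneg_right (pow_le_pow_left₀ (by positivity) ?_ _) (by positivity)
    have h3 : (n : ℝ) ≤ n₁ + (((n : ℤ) - n₁).natAbs : ℝ) := by
      have : n ≤ n₁ + ((n : ℤ) - n₁).natAbs := by omega
      exact_mod_cast this
    nlinarith [mul_nonneg (Nat.cast_nonneg (α := ℝ) n₁)
      (Nat.cast_nonneg (α := ℝ) ((n : ℤ) - n₁).natAbs)]
  refine (Finset.sum_le_sum fun n _ => h2 n).trans ?_
  rw [← Finset.mul_sum, mul_comm]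
  refine mul_le_mul_of_nonneg_right ?_ (by positivity)
  have hinj : Function.Injective fun n : ℕ => (n : ℤ) - n₁ := fun a b h => by
    simpa using h
  have hmap := Finset.sum_map (Finset.range ((d + 1) * N + 1)) ⟨_, hinj⟩ G
  simp only [Function.Embedding.coeFn_mk] at hmap
  rw [← hmap]
  have := hs.sum_le_tsum (Finset.map ⟨_, hinj⟩ (Finset.range ((d + 1) * N + 1)))
    (fun z _ => hG0 z)
  linarith

lemma sqrt_log_card_div_le (d K : ℕ) {m n₁ N : ℕ} (hm : 1 ≤ m) (hmn : 2 ^ n₁ * (n₁ + 1) ≤ 2 * m)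
    (hN : N = K * (n₁ + 1)) :
    √(log (2 * Fintype.card (Fin (d + 1) → Fin (2 ^ N))) / m) ≤
      √(2 * (2 * ((K : ℝ) * (d + 1) + 1))) * (2 : ℝ) ^ (-(n₁ / 2 : ℝ)) := by
  have hE0 : 0 ≤ 2 * (2 * ((K : ℝ) * (d + 1) + 1)) := by positivity
  have hpow : ((2 : ℝ) ^ (-(n₁ / 2 : ℝ))) ^ 2 = ((2 : ℝ) ^ n₁)⁻¹ := by
    rw [← rpow_natCast, ← rpow_mul zero_le_two, ← rpow_natCast 2 n₁, ← rpow_neg zero_le_two]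
    congr 1; push_cast; ring
  have hm0 : (0 : ℝ) < m := by exact_mod_cast hm
  refine Real.sqrt_le_iff.2 ⟨by positivity, ?_⟩
  rw [mul_pow, Real.sq_sqrt hE0, hpow, div_le_iff₀ hm0]
  have hX : (2 * (Fintype.card (Fin (d + 1) → Fin (2 ^ N)) : ℝ)) = 2 ^ (N * (d + 1) + 1) := by
    rw [Fintype.card_fun, Fintype.card_fin, Fintype.card_fin]
    push_cast
    rw [← pow_mul, pow_succ']
  rw [hX, log_pow, hN]
  have hlog2 : log 2 ≤ 1 := by have := log_two_lt_d9; linarith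
  have hmn' : (2 : ℝ) ^ n₁ * (n₁ + 1) ≤ 2 * m := by exact_mod_cast hmn
  have h2n : (0 : ℝ) < 2 ^ n₁ := by positivity
  have h3 : ((n₁ : ℝ) + 1) ≤ 2 * m * ((2 : ℝ) ^ n₁)⁻¹ := by
    rw [← div_eq_mul_inv, le_div_iff₀ h2n]; linarith
  have h4 : ((K * (n₁ + 1) * (d + 1) + 1 : ℕ) : ℝ) ≤ (K * (d + 1) + 1) * (n₁ + 1) := by
    push_cast
    nlinarith [Nat.cast_nonneg (α := ℝ) n₁]
  calc ((K * (n₁ + 1) * (d + 1) + 1 : ℕ) : ℝ) * log 2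
      ≤ ((K * (d + 1) + 1) * (n₁ + 1)) * 1 := by gcongr
    _ ≤ (K * (d + 1) + 1) * (2 * m * ((2 : ℝ) ^ n₁)⁻¹) := by rw [mul_one]; gcongr
    _ ≤ 2 * (2 * (K * (d + 1) + 1)) * ((2 : ℝ) ^ n₁)⁻¹ * m := by
      have : 0 ≤ (K * ((d : ℝ) + 1) + 1) * (2 * m * ((2 : ℝ) ^ n₁)⁻¹) := by positivity
      linarith

/-- Widths of the discretized class: the level-`s` coefficients lie in an `ℓ_p`-ball. -/
lemma exists_subspace_discrete_class (d : ℕ) {p r : ℝ} (hp : 2 < p) (hrp : 1 / p < r)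
    (hr : r < 1 / 2) {C₀ : ℝ} (hC₀ : 0 < C₀) (K : ℕ) :
    ∃ C : ℝ, 0 < C ∧ ∀ m n₁ : ℕ, 1 ≤ m → 2 ^ n₁ * (n₁ + 1) ≤ 2 * m →
      ∀ N : ℕ, N = K * (n₁ + 1) →
      ∀ π' : ∀ s : Fin (d + 1) → Fin (N + 1),
        (Fin (d + 1) → Fin (2 ^ N)) → (∀ i, Fin (2 ^ (s i : ℕ))),
      ∃ W : Submodule ℂ ((Fin (d + 1) → Fin (2 ^ N)) → ℂ), Module.finrank ℂ W ≤ m ∧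
        ∀ v : ∀ s : Fin (d + 1) → Fin (N + 1), (∀ i, Fin (2 ^ (s i : ℕ))) → ℂ,
          (∀ s, ∑ k, ‖v s k‖ ^ p ≤
            C₀ * (2 : ℝ) ^ ((1 - r * p) * ((∑ i, (s i : ℕ) : ℕ) : ℝ))) →
          ∃ b ∈ W, ∀ x, ‖∑ s, v s (π' s x) - b x‖ ≤
            C * ((n₁ : ℝ) + 1) ^ d * (2 : ℝ) ^ (-(r * n₁)) := by
  have hp0 : 0 < p := by linarith
  have hr0 : 0 < r := lt_trans (by positivity) hrp
  have hrp1 : 1 < r * p := by rwa [div_lt_iff₀ hp0] at hrp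
  obtain ⟨a, ha1, ha2⟩ : ∃ a, (1 / 2 - r) / (p / 2 - 1) < a ∧ a < r := by
    refine exists_between ?_
    rw [div_lt_iff₀ (by linarith)]
    linarith
  have ha0 : 0 < a := lt_trans (div_pos (by linarith) (by linarith)) ha1
  rw [div_lt_iff₀ (by linarith)] at ha1
  set β := a * (p / 2 - 1) with hβ
  obtain ⟨γ, hγ0, hγ1, hγ2, hγ3⟩ : ∃ γ : ℝ, 0 < γ ∧ γ ≤ 1 / 2 - r ∧ γ ≤ β - (1 / 2 - r) ∧
      γ ≤ r - a :=
    ⟨min (1 / 2 - r) (min (β - (1 / 2 - r)) (r - a)),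
      lt_min (by linarith) (lt_min (by linarith) (by linarith)), min_le_left _ _,
      (min_le_right _ _).trans (min_le_left _ _), (min_le_right _ _).trans (min_le_right _ _)⟩
  set ρ : ℝ := (2 : ℝ) ^ (-γ) with hρ
  have hρ0 : 0 < ρ := by positivity
  have hρ1 : ρ < 1 := rpow_lt_one_of_one_lt_of_neg one_lt_two (by linarith)
  have hρpow : ∀ k : ℕ, ρ ^ k = (2 : ℝ) ^ (-γ * k) := fun k => by
    rw [hρ, ← rpow_natCast, ← rpow_mul zero_le_two]
  obtain ⟨Cρ, hCρ, hsum⟩ := exists_sum_level_geometric_le d hρ0 hρ1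
  set c := √(1 + C₀) with hc
  have hc0 : 0 < c := Real.sqrt_pos.2 (by linarith)
  have hc2 : c ^ 2 = 1 + C₀ := Real.sq_sqrt (by linarith)
  set E : ℝ := 2 * (K * (d + 1) + 1) with hE
  have hE0 : 0 < E := by positivity
  refine ⟨Cρ + 202 * c * Cρ * √(2 * E), by positivity, fun m n₁ hm hmn N hN π' => ?_⟩
  set lev : (Fin (d + 1) → Fin (N + 1)) → ℕ := fun s => ∑ i, (s i : ℕ) with hlev
  set A : (Fin (d + 1) → Fin (N + 1)) → ℝ := fun s =>
    c * (2 : ℝ) ^ ((1 / 2 - r) * lev s - β * ((lev s - n₁ : ℕ) : ℝ)) with hA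
  set τ : ℕ → ℝ := fun n => (2 : ℝ) ^ (-(r * n) + a * ((n : ℝ) - n₁)) with hτ
  obtain ⟨W, hW, hWh⟩ := exists_subspace_approx_sum π' (A := A) (fun s => by positivity) hm
  refine ⟨W, hW, fun v hv => ?_⟩
  have hsplit : ∀ s, ∃ g h : (∀ i, Fin (2 ^ (s i : ℕ))) → ℂ, (∀ k, v s k = g k + h k) ∧
      (∀ k, ‖g k‖ ≤ (2 : ℝ) ^ (-(r * n₁)) * ρ ^ ((lev s : ℤ) - n₁).natAbs) ∧
      ∑ k, ‖h k‖ ^ 2 ≤ A s ^ 2 := by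
    intro s
    have hA2 : A s ^ 2 =
        (1 + C₀) * (2 : ℝ) ^ ((1 - 2 * r) * lev s - 2 * β * ((lev s - n₁ : ℕ) : ℝ)) := by
      simp only [hA]
      rw [mul_pow, hc2, ← rpow_natCast, ← rpow_mul zero_le_two]
      congr 2; push_cast; ring
    rw [hA2]
    have hv' : ∑ k, ‖v s k‖ ^ p ≤ C₀ * (2 : ℝ) ^ ((1 - r * p) * (lev s : ℝ)) := hv s
    rcases le_or_gt (lev s) n₁ with hle | hgt
    · refine ⟨0, v s, fun k => by simp, fun k => by simp; positivity, ?_⟩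
      refine (sum_norm_sq_le_of_sum_rpow_le hp (v s) (τ := (2 : ℝ) ^ (-(r * lev s)))
        (by positivity) hv').trans (le_of_eq ?_)
      have hcard : (Fintype.card (∀ i, Fin (2 ^ (s i : ℕ))) : ℝ) = (2 : ℝ) ^ (lev s : ℝ) := by
        rw [Fintype.card_pi]
        simp only [Fintype.card_fin]
        rw [Finset.prod_pow_eq_pow_sum, rpow_natCast]
        push_cast
        rfl
      rw [hcard, Nat.sub_eq_zero_of_le hle, ← rpow_mul zero_le_two,
        ← rpow_natCast (2 ^ _) 2, ← rpow_mul zero_le_two, ← rpow_add zero_lt_two,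
        mul_left_comm, ← rpow_add zero_lt_two, add_mul, one_mul]
      congr 2
      · simp only [Nat.cast_ofNat, Nat.cast_zero]; ring
      · congr 1; simp only [Nat.cast_zero]; ring
    · obtain ⟨g, h, hgh, hg, hh⟩ := exists_truncation hp (v s) (τ := τ (lev s))
        (by positivity) hv'
      have hcast : ((lev s - n₁ : ℕ) : ℝ) = lev s - n₁ := Nat.cast_sub hgt.le
      refine ⟨g, h, hgh, fun k => (hg k).trans ?_, hh.trans ?_⟩
      · rw [hρpow, ← rpow_add zero_lt_two]
        have e : ((((lev s : ℤ) - n₁).natAbs : ℕ) : ℝ) = lev s - n₁ := by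
          rw [← hcast]; congr 1; omega
        rw [e]
        refine rpow_le_rpow_of_exponent_le one_le_two ?_
        have : (0 : ℝ) ≤ lev s - n₁ := by rw [← hcast]; positivity
        nlinarith
      · simp only [hτ]
        rw [← rpow_mul zero_le_two, mul_left_comm, ← rpow_add zero_lt_two]
        refine mul_le_mul (by linarith) (le_of_eq ?_) (by positivity) (by linarith)
        congr 1
        rw [hcast, hβ]
        ring
  choose g h hgh hg hh using hsplit
  obtain ⟨b, hb, hb'⟩ := hWh h hh
  refine ⟨b, hb, fun x => ?_⟩
  have hsumA : ∑ s, A s ≤ c * (2 : ℝ) ^ ((1 / 2 - r) * n₁) * (Cρ * ((n₁ : ℝ) + 1) ^ d) := by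
    refine le_trans ?_ (mul_le_mul_of_nonneg_left (hsum n₁ N) (by positivity))
    rw [Finset.mul_sum]
    refine Finset.sum_le_sum fun s _ => ?_
    change A s ≤ c * (2 : ℝ) ^ ((1 / 2 - r) * n₁) * ρ ^ ((lev s : ℤ) - n₁).natAbs
    simp only [hA]
    rw [hρpow, mul_assoc c, ← rpow_add zero_lt_two]
    refine mul_le_mul_of_nonneg_left (rpow_le_rpow_of_exponent_le one_le_two ?_) hc0.le
    rcases le_or_gt (lev s) n₁ with hle | hgt
    · have e : ((((lev s : ℤ) - n₁).natAbs : ℕ) : ℝ) = n₁ - lev s := by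
        rw [← Nat.cast_sub hle]; exact congrArg (Nat.cast (R := ℝ)) (by omega)
      rw [e, Nat.sub_eq_zero_of_le hle]
      have : (0 : ℝ) ≤ n₁ - lev s := by rw [← Nat.cast_sub hle]; positivity
      push_cast
      nlinarith
    · have e : ((((lev s : ℤ) - n₁).natAbs : ℕ) : ℝ) = lev s - n₁ := by
        rw [← Nat.cast_sub (R := ℝ) hgt.le]; exact congrArg (Nat.cast (R := ℝ)) (by omega)
      rw [e, Nat.cast_sub hgt.le]
      have : (0 : ℝ) ≤ lev s - n₁ := by rw [← Nat.cast_sub hgt.le]; positivity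
      nlinarith
  have hsumg : ‖∑ s, g s (π' s x)‖ ≤ (2 : ℝ) ^ (-(r * n₁)) * (Cρ * ((n₁ : ℝ) + 1) ^ d) := by
    refine (norm_sum_le _ _).trans ((Finset.sum_le_sum fun s _ => hg s _).trans ?_)
    rw [← Finset.mul_sum]
    exact mul_le_mul_of_nonneg_left (hsum n₁ N) (by positivity)
  have hroot : √(log (2 * Fintype.card (Fin (d + 1) → Fin (2 ^ N))) / m) ≤
      √(2 * E) * (2 : ℝ) ^ (-(n₁ / 2 : ℝ)) := sqrt_log_card_div_le d K hm hmn hN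
  have hdecomp : ∑ s, v s (π' s x) - b x =
      ∑ s, g s (π' s x) + (∑ s, h s (π' s x) - b x) := by
    simp only [hgh]
    rw [Finset.sum_add_distrib]; ring
  rw [hdecomp]
  refine (norm_add_le _ _).trans ((add_le_add hsumg (hb' x)).trans ?_)
  have hfin : 202 * (∑ s, A s) * √(log (2 * Fintype.card (Fin (d + 1) → Fin (2 ^ N))) / m) ≤
      202 * (c * (2 : ℝ) ^ ((1 / 2 - r) * n₁) * (Cρ * ((n₁ : ℝ) + 1) ^ d)) *
        (√(2 * E) * (2 : ℝ) ^ (-(n₁ / 2 : ℝ))) := by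
    gcongr
  refine (add_le_add_right hfin _).trans (le_of_eq ?_)
  have hexp : (2 : ℝ) ^ (-(r * n₁)) =
      (2 : ℝ) ^ ((1 / 2 - r) * n₁) * (2 : ℝ) ^ (-(n₁ / 2 : ℝ)) := by
    rw [← rpow_add zero_lt_two]; congr 1; ring
  rw [hexp]
  ring

/-- The coordinate on the circle normalized to `[0, 1)`. -/
def unitCoord (x : AddCircle (2 * π)) : ℝ := (AddCircle.equivIco (2 * π) 0 x : ℝ) / (2 * π)

lemma unitCoord_nonneg (x : AddCircle (2 * π)) : 0 ≤ unitCoord x :=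
  div_nonneg (AddCircle.equivIco (2 * π) 0 x).2.1 (by positivity)

lemma unitCoord_lt_one (x : AddCircle (2 * π)) : unitCoord x < 1 := by
  have := (AddCircle.equivIco (2 * π) 0 x).2.2
  rw [unitCoord, div_lt_one (by positivity)]
  linarith

lemma coe_unitCoord (x : AddCircle (2 * π)) :
    ((2 * π * unitCoord x : ℝ) : AddCircle (2 * π)) = x := by
  rw [unitCoord, mul_div_cancel₀ _ (by positivity)]
  exact (AddCircle.equivIco (2 * π) 0).symm_apply_apply x

lemma unitCoord_coe (x : ℝ) : unitCoord (x : AddCircle (2 * π)) = Int.fract (x / (2 * π)) := by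
  rw [unitCoord, AddCircle.coe_equivIco_mk_apply, mul_div_cancel_right₀ _ (by positivity)]

lemma measurable_unitCoord : Measurable unitCoord := by
  have := (AddCircle.measurableEquivIco (2 * π) 0).measurable
  exact (measurable_subtype_coe.comp this).div_const _

/-- The index of the dyadic interval of level `j` containing `x`. -/
def dyadicCell (j : ℕ) (x : AddCircle (2 * π)) : ℕ := ⌊2 ^ j * unitCoord x⌋₊

lemma dyadicCell_lt (j : ℕ) (x : AddCircle (2 * π)) : dyadicCell j x < 2 ^ j := by
  rw [dyadicCell, Nat.floor_lt (mul_nonneg (by positivity) (unitCoord_nonneg x))]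
  have := unitCoord_lt_one x
  push_cast
  exact mul_lt_of_lt_one_right (by positivity) this

lemma measurable_dyadicCell (j : ℕ) : Measurable (dyadicCell j) :=
  Nat.measurable_floor.comp (measurable_unitCoord.const_mul _)

lemma dyadicCell_div (j i : ℕ) (x : AddCircle (2 * π)) :
    dyadicCell (j + i) x / 2 ^ i = dyadicCell j x := by
  rw [dyadicCell, dyadicCell, ← Nat.floor_div_natCast]
  congr 1
  push_cast
  rw [pow_add]
  field_simp

lemma dyadicCell_sub_eq_iff (j : ℕ) (x : AddCircle (2 * π)) {a : ℕ} (ha : a + 1 < 2 ^ j) :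
    dyadicCell j (x - ((2 * π / 2 ^ j : ℝ) : AddCircle (2 * π))) = a ↔
      dyadicCell j x = a + 1 := by
  have h0 := unitCoord_nonneg x
  have h1 := unitCoord_lt_one x
  have hj : (0 : ℝ) < 2 ^ j := by positivity
  have hu : unitCoord (x - ((2 * π / 2 ^ j : ℝ) : AddCircle (2 * π))) =
      Int.fract (unitCoord x - (2 ^ j)⁻¹) := by
    conv_lhs => rw [← coe_unitCoord x, ← AddCircle.coe_sub, unitCoord_coe]
    congr 1
    field_simp
  have hinv : (2 ^ j : ℝ) * (2 ^ j)⁻¹ = 1 := mul_inv_cancel₀ hj.ne'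
  have hinv1 : ((2 : ℝ) ^ j)⁻¹ ≤ 1 := inv_le_one_of_one_le₀ (one_le_pow₀ one_le_two)
  have hinv0 : 0 < ((2 : ℝ) ^ j)⁻¹ := by positivity
  rw [dyadicCell, dyadicCell, hu]
  rcases le_or_gt ((2 : ℝ) ^ j)⁻¹ (unitCoord x) with h | h
  · rw [Int.fract_eq_self.2 ⟨by linarith, by linarith⟩, mul_sub, hinv, Nat.floor_sub_one]
    have : 1 ≤ ⌊2 ^ j * unitCoord x⌋₊ := by
      rw [Nat.one_le_floor_iff, ← hinv]
      exact mul_le_mul_of_nonneg_left h hj.le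
    omega
  · have hf : Int.fract (unitCoord x - (2 ^ j)⁻¹) = unitCoord x - (2 ^ j)⁻¹ + 1 := by
      rw [Int.fract_eq_iff]
      exact ⟨by linarith, by linarith, -1, by push_cast; ring⟩
    have hz : ⌊2 ^ j * unitCoord x⌋₊ = 0 := by
      rw [Nat.floor_eq_zero, ← hinv]
      exact mul_lt_mul_of_pos_left h hj
    have hb : 2 ^ j - 1 ≤ ⌊2 ^ j * Int.fract (unitCoord x - (2 ^ j)⁻¹)⌋₊ := by
      refine Nat.le_floor ?_
      rw [hf, Nat.cast_sub Nat.one_le_two_pow]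
      push_cast
      nlinarith
    omega

/-- The normalized indicator function of a dyadic interval. -/
def dyadicKernel (j a : ℕ) (y : AddCircle (2 * π)) : ℝ :=
  if dyadicCell j y = a then 2 ^ j / (2 * π) else 0

/-- The reproducing kernel of the level `j` Haar projection. -/
def haarKernel : ℕ → ℕ → AddCircle (2 * π) → ℝ
  | 0, a, y => dyadicKernel 0 a y
  | j + 1, a, y => dyadicKernel (j + 1) a y - dyadicKernel j (a / 2) y

lemma dyadicKernel_nonneg (j a : ℕ) (y : AddCircle (2 * π)) : 0 ≤ dyadicKernel j a y := by
  unfold dyadicKernel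
  split_ifs
  · positivity
  · exact le_rfl

lemma dyadicKernel_le (j a : ℕ) (y : AddCircle (2 * π)) :
    dyadicKernel j a y ≤ 2 ^ j / (2 * π) := by
  unfold dyadicKernel
  split_ifs
  · exact le_rfl
  · positivity

lemma measurable_dyadicKernel (j a : ℕ) : Measurable (dyadicKernel j a) :=
  Measurable.ite (measurable_dyadicCell j (measurableSet_singleton a)) measurable_const
    measurable_const

lemma sum_haarKernel (N : ℕ) (x y : AddCircle (2 * π)) :
    ∑ j ∈ Finset.range (N + 1), haarKernel j (dyadicCell j x) y =
      dyadicKernel N (dyadicCell N x) y := by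
  induction N with
  | zero => simp [haarKernel]
  | succ N ih =>
    rw [Finset.sum_range_succ, ih, haarKernel]
    have := dyadicCell_div N 1 x
    rw [pow_one] at this
    rw [this]
    ring

lemma exists_haarKernel_eq {j a : ℕ} (ha : a < 2 ^ j) :
    ∃ σ : ℝ, |σ| ≤ 1 ∧ ∀ y, haarKernel j a y = σ * (dyadicKernel j (2 * (a / 2)) y -
      if j ≠ 0 then
        dyadicKernel j (2 * (a / 2)) (y - ((2 * π / 2 ^ j : ℝ) : AddCircle (2 * π))) else 0) := by
  cases j with
  | zero =>
    refine ⟨1, by simp, fun y => ?_⟩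
    have : a = 0 := by simpa using ha
    simp [haarKernel, this]
  | succ j =>
    have hpow : 2 ^ (j + 1) = 2 * 2 ^ j := pow_succ' 2 j
    have key : ∀ y, haarKernel (j + 1) a y =
        (if a % 2 = 0 then 1 / 2 else -(1 / 2) : ℝ) * (dyadicKernel (j + 1) (2 * (a / 2)) y -
        dyadicKernel (j + 1) (2 * (a / 2))
          (y - ((2 * π / 2 ^ (j + 1) : ℝ) : AddCircle (2 * π)))) := fun y => by
      have hsub := dyadicCell_sub_eq_iff (j + 1) y (a := 2 * (a / 2)) (by omega)
      have hdiv := dyadicCell_div j 1 y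
      rw [pow_one] at hdiv
      have hp : (2 : ℝ) ^ (j + 1) / (2 * π) = 2 * (2 ^ j / (2 * π)) := by
        rw [pow_succ]; ring
      simp only [haarKernel, dyadicKernel, hsub, ← hdiv, hp]
      rcases Nat.mod_two_eq_zero_or_one a with h | h <;>
        simp only [h, if_true, one_ne_zero, if_false] <;> split_ifs <;>
        first | omega | ring
    refine ⟨if a % 2 = 0 then 1 / 2 else -(1 / 2), ?_, fun y => by
      rw [key y, if_pos (Nat.succ_ne_zero j)]⟩
    split_ifs <;> norm_num [abs_le]

lemma integral_dyadicKernel {j a : ℕ} (ha : a < 2 ^ j) : ∫ y, dyadicKernel j a y = 1 := by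
  have h_int : ∀ a, Integrable (dyadicKernel j a) volume := fun a =>
    Integrable.of_bound (measurable_dyadicKernel j a).aestronglyMeasurable (2 ^ j / (2 * π))
      (.of_forall fun y => by
        rw [Real.norm_of_nonneg (dyadicKernel_nonneg j a y)]; exact dyadicKernel_le j a y)
  have hstep : ∀ a, a + 1 < 2 ^ j → ∫ y, dyadicKernel j (a + 1) y = ∫ y, dyadicKernel j a y := by
    intro a ha
    rw [← integral_sub_right_eq_self (dyadicKernel j a)
      ((2 * π / 2 ^ j : ℝ) : AddCircle (2 * π))]
    congr 1
    funext y
    simp only [dyadicKernel, dyadicCell_sub_eq_iff j y ha]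
  have hconst : ∀ a, a < 2 ^ j → ∫ y, dyadicKernel j a y = ∫ y, dyadicKernel j 0 y := by
    intro a
    induction a with
    | zero => exact fun _ => rfl
    | succ a ih => exact fun h => (hstep a h).trans (ih (by omega))
  have hsum : ∑ a ∈ Finset.range (2 ^ j), ∫ y, dyadicKernel j a y = 2 ^ j := by
    rw [← integral_finsetSum _ fun a _ => h_int a]
    have : ∀ y, ∑ a ∈ Finset.range (2 ^ j), dyadicKernel j a y = 2 ^ j / (2 * π) := fun y => by
      simp [dyadicKernel, dyadicCell_lt]
    simp only [this, integral_const, smul_eq_mul, Measure.real, AddCircle.measure_univ]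
    rw [ENNReal.toReal_ofReal (by positivity)]
    field_simp
  rw [Finset.sum_congr rfl fun a h => hconst a (Finset.mem_range.1 h), Finset.sum_const,
    Finset.card_range, nsmul_eq_mul] at hsum
  rw [hconst a ha]
  push_cast at hsum
  exact mul_left_cancel₀ (by positivity : (2 : ℝ) ^ j ≠ 0) (by rw [hsum, mul_one])

lemma prod_sub_ite_eq_sum_powerset {ι : Type*} [Fintype ι] [DecidableEq ι] (A B : ι → ℝ)
    (e : Finset ι) :
    ∏ i, (B i - if i ∈ e then A i else 0) =
      ∑ u ∈ e.powerset, (-1) ^ u.card * ∏ i, (if i ∈ u then A i else B i) := by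
  have h1 : ∀ i, (B i - if i ∈ e then A i else 0) = (if i ∈ e then -A i else 0) + B i := fun i => by
    split_ifs <;> ring
  simp only [h1]
  rw [Finset.prod_add]
  symm
  refine Finset.sum_subset_zero_on_sdiff (Finset.powerset_mono.2 (Finset.subset_univ e)) ?_ ?_
  · intro u hu
    simp only [Finset.mem_sdiff, Finset.mem_powerset] at hu
    obtain ⟨i, hiu, hie⟩ := Finset.not_subset.1 hu.2
    rw [Finset.prod_eq_zero hiu (by simp [hie]), zero_mul]
  · intro u hu
    rw [Finset.mem_powerset] at hu
    rw [Finset.prod_congr rfl (g := fun i => -A i) (fun i hi => if_pos (hu hi)),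
      Finset.prod_neg, Finset.prod_ite, mul_assoc]
    congr 2
    · exact Finset.prod_congr (by ext; simp) fun _ _ => rfl
    · exact Finset.prod_congr (by ext; simp) fun _ _ => rfl

/-- The normalized indicator function of a dyadic box. -/
def cellKernel {D : ℕ} (s b : Fin D → ℕ) (y : Torus D) : ℝ :=
  ∏ i, dyadicKernel (s i) (b i) (y i)

section

variable {D : ℕ}

lemma cellKernel_nonneg (s b : Fin D → ℕ) (y : Torus D) : 0 ≤ cellKernel s b y :=
  Finset.prod_nonneg fun _ _ => dyadicKernel_nonneg _ _ _

lemma cellKernel_le (s b : Fin D → ℕ) (y : Torus D) :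
    cellKernel s b y ≤ ∏ i, ((2 : ℝ) ^ s i / (2 * π)) :=
  Finset.prod_le_prod (fun _ _ => dyadicKernel_nonneg _ _ _) fun _ _ => dyadicKernel_le _ _ _

lemma measurable_cellKernel (s b : Fin D → ℕ) : Measurable (cellKernel s b) :=
  Finset.measurable_prod _ fun i _ =>
    (measurable_dyadicKernel (s i) (b i)).comp (measurable_pi_apply i)

lemma integral_cellKernel {s b : Fin D → ℕ} (hb : ∀ i, b i < 2 ^ s i) :
    ∫ y, cellKernel s b y = 1 := by
  unfold cellKernel
  rw [integral_fintype_prod_volume_eq_prod (fun i => dyadicKernel (s i) (b i))]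
  exact Finset.prod_eq_one fun i _ => integral_dyadicKernel (hb i)

lemma integrable_cellKernel_smul {E : Type*} [NormedAddCommGroup E] [NormedSpace ℝ E]
    (s b : Fin D → ℕ) {f : Torus D → E} (hf : Integrable f) :
    Integrable fun y => cellKernel s b y • f y :=
  hf.bdd_smul (∏ i, ((2 : ℝ) ^ s i / (2 * π))) (measurable_cellKernel s b).aestronglyMeasurable
    (.of_forall fun y => by
      rw [Real.norm_of_nonneg (cellKernel_nonneg s b y)]; exact cellKernel_le s b y)

/-- The shift entering the definition of the mixed differences. -/
def coordShift (u : Finset (Fin D)) (h : Fin D → ℝ) : Torus D :=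
  fun j => if j ∈ u then ((h j : ℝ) : AddCircle (2 * π)) else 0

/-- The Haar coefficients of a function on the torus. -/
def haarCoeff (f : Torus D → ℂ) (s k : Fin D → ℕ) : ℂ :=
  ∫ y, (∏ i, haarKernel (s i) (k i) (y i)) • f y

/-- The coordinates of positive level. -/
def levelSupport (s : Fin D → ℕ) : Finset (Fin D) := Finset.univ.filter fun i => s i ≠ 0

/-- The increments associated with a level. -/
def levelIncrement (s : Fin D → ℕ) : Fin D → ℝ := fun i =>
  if s i ≠ 0 then 2 * π / 2 ^ s i else π

lemma haarCoeff_eq {f : Torus D → ℂ} (hf : Integrable f) {s k : Fin D → ℕ}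
    (hk : ∀ i, k i < 2 ^ s i) :
    ∃ σ : ℝ, |σ| ≤ 1 ∧ haarCoeff f s k = σ • ∫ y, cellKernel s (fun i => 2 * (k i / 2)) y •
      mixedDiff (levelSupport s) (levelIncrement s) f y := by
  choose σ hσ hσk using fun i => exists_haarKernel_eq (hk i)
  set e := levelSupport s with he
  set b : Fin D → ℕ := fun i => 2 * (k i / 2) with hb
  have hmem : ∀ i, i ∈ e ↔ s i ≠ 0 := fun i => by simp [he, levelSupport]
  have hkernel : ∀ y : Torus D, ∏ i, haarKernel (s i) (k i) (y i) =
      (∏ i, σ i) * ∑ u ∈ e.powerset, (-1) ^ u.card *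
        cellKernel s b (y - coordShift u (levelIncrement s)) := fun y => by
    simp only [hσk, Finset.prod_mul_distrib, ← hmem]
    rw [prod_sub_ite_eq_sum_powerset]
    congr 1
    refine Finset.sum_congr rfl fun u hu => ?_
    congr 1
    refine Finset.prod_congr rfl fun i _ => ?_
    simp only [coordShift, levelIncrement, Pi.sub_apply]
    split_ifs with h1 h2
    · rfl
    · exact absurd ((hmem i).1 (Finset.mem_powerset.1 hu h1)) h2
    · rw [sub_zero]
  have hshift : ∀ u, Integrable fun y => f (y + coordShift u (levelIncrement s)) := fun u =>
    hf.comp_add_right _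
  have h_int : ∀ u, Integrable fun y =>
      cellKernel s b (y - coordShift u (levelIncrement s)) • f y := fun u => by
    have := (integrable_cellKernel_smul s b (hshift u)).comp_sub_right
      (coordShift u (levelIncrement s))
    simpa using this
  have htrans : ∀ u, ∫ y, cellKernel s b (y - coordShift u (levelIncrement s)) • f y =
      ∫ y, cellKernel s b y • f (y + coordShift u (levelIncrement s)) := fun u => by
    rw [← integral_sub_right_eq_self (fun y => cellKernel s b y •
      f (y + coordShift u (levelIncrement s))) (coordShift u (levelIncrement s))]
    simp
  have h_int' : ∀ u : Finset (Fin D), Integrable fun y => (-1 : ℝ) ^ u.card •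
      cellKernel s b (y - coordShift u (levelIncrement s)) • f y := fun u =>
    (h_int u).smul ((-1 : ℝ) ^ u.card)
  have hshift' : ∀ u : Finset (Fin D), Integrable fun y => (-1 : ℝ) ^ (e.card - u.card) •
      cellKernel s b y • f (y + coordShift u (levelIncrement s)) := fun u =>
    (integrable_cellKernel_smul s b (hshift u)).smul ((-1 : ℝ) ^ (e.card - u.card))
  refine ⟨(∏ i, σ i) * (-1) ^ e.card, ?_, ?_⟩
  · rw [abs_mul, abs_pow, abs_neg, abs_one, one_pow, mul_one, Finset.abs_prod]
    exact Finset.prod_le_one (fun i _ => abs_nonneg _) fun i _ => hσ i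
  · have hl : haarCoeff f s k = (∏ i, σ i) • ∑ u ∈ e.powerset, ((-1 : ℝ) ^ u.card) •
        ∫ y, cellKernel s b y • f (y + coordShift u (levelIncrement s)) := by
      unfold haarCoeff
      simp only [hkernel, mul_smul, Finset.sum_smul]
      rw [integral_smul, integral_finsetSum _ fun u _ => h_int' u]
      simp only [integral_smul, htrans]
    have hr : ∫ y, cellKernel s b y • mixedDiff e (levelIncrement s) f y =
        ∑ u ∈ e.powerset, ((-1 : ℝ) ^ (e.card - u.card)) •
          ∫ y, cellKernel s b y • f (y + coordShift u (levelIncrement s)) := by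
      have : ∀ y, cellKernel s b y • mixedDiff e (levelIncrement s) f y =
          ∑ u ∈ e.powerset, ((-1 : ℝ) ^ (e.card - u.card)) •
            (cellKernel s b y • f (y + coordShift u (levelIncrement s))) := fun y => by
        have hm : mixedDiff e (levelIncrement s) f y = ∑ u ∈ e.powerset,
          (-1 : ℂ) ^ (e.card - u.card) * f (y + coordShift u (levelIncrement s)) := rfl
        rw [hm, Finset.smul_sum]
        refine Finset.sum_congr rfl fun u _ => ?_
        simp only [Complex.real_smul]
        push_cast
        ring
      simp only [this]
      rw [integral_finsetSum _ fun u _ => hshift' u]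
      simp only [integral_smul]
    rw [hl, hr, mul_smul]
    congr 1
    rw [Finset.smul_sum]
    refine Finset.sum_congr rfl fun u hu => ?_
    rw [← mul_smul]
    congr 1
    have hcard := Finset.card_le_card (Finset.mem_powerset.1 hu)
    obtain ⟨c, hc⟩ := Nat.exists_eq_add_of_le hcard
    rw [hc, Nat.add_sub_cancel_left, pow_add, mul_assoc, ← mul_pow]
    norm_num

lemma rpow_integral_cellKernel_le {s b : Fin D → ℕ} (hb : ∀ i, b i < 2 ^ s i) {p : ℝ}
    (hp : 1 ≤ p) {G : Torus D → ℝ} (hG0 : ∀ y, 0 ≤ G y) (hG : Integrable G)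
    (hGp : Integrable fun y => G y ^ p) :
    (∫ y, cellKernel s b y * G y) ^ p ≤ ∫ y, cellKernel s b y * G y ^ p := by
  set Q : Set (Torus D) := {y | ∀ i, dyadicCell (s i) (y i) = b i} with hQ
  set c : ℝ := ∏ i, ((2 : ℝ) ^ s i / (2 * π)) with hc
  have hQm : MeasurableSet Q := by
    rw [hQ, Set.ofPred_forall]
    exact MeasurableSet.iInter fun i => (measurable_dyadicCell (s i)).comp (measurable_pi_apply i)
      (measurableSet_singleton _)
  have hker : ∀ (g : Torus D → ℝ) y, cellKernel s b y * g y = Q.indicator (fun y => c * g y) y := by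
    intro g y
    by_cases hy : y ∈ Q
    · rw [Set.indicator_of_mem hy]
      congr 1
      exact Finset.prod_congr rfl fun i _ => if_pos (hy i)
    · rw [Set.indicator_of_notMem hy]
      obtain ⟨i, hi⟩ := not_forall.1 hy
      rw [cellKernel, Finset.prod_eq_zero (Finset.mem_univ i) (if_neg hi), zero_mul]
  have h_int : ∀ g : Torus D → ℝ, ∫ y, cellKernel s b y * g y = c * ∫ y in Q, g y := fun g => by
    simp only [hker]
    rw [integral_indicator hQm, integral_const_mul]
  have hone : c * volume.real Q = 1 := by
    have := h_int fun _ => 1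
    simp only [mul_one, integral_cellKernel hb] at this
    rw [this]
    simp
  have hQ0 : volume.real Q ≠ 0 := right_ne_zero_of_mul_eq_one hone
  have hQc : c = (volume.real Q)⁻¹ := eq_inv_of_mul_eq_one_left hone
  have := (convexOn_rpow hp).map_set_average_le (f := G) (t := Q) (μ := volume)
    (continuousOn_id.rpow_const fun _ _ => Or.inr (by linarith)) isClosed_Ici
    (fun h => hQ0 (by simp [Measure.real, h])) (measure_ne_top _ _)
    (.of_forall hG0) hG.integrableOn hGp.integrableOn
  rw [setAverage_eq, setAverage_eq, smul_eq_mul, smul_eq_mul, ← hQc] at this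
  rw [h_int, h_int]
  exact this

lemma sum_dyadicKernel_le (j : ℕ) (y : AddCircle (2 * π)) :
    ∑ a ∈ Finset.range (2 ^ j), dyadicKernel j (2 * (a / 2)) y ≤ 2 * (2 ^ j / (2 * π)) := by
  simp only [dyadicKernel]
  rw [Finset.sum_ite, Finset.sum_const_zero, add_zero, Finset.sum_const, nsmul_eq_mul]
  refine mul_le_mul_of_nonneg_right ?_ (by positivity)
  have h : (Finset.range (2 ^ j)).filter (fun a => dyadicCell j y = 2 * (a / 2)) ⊆
      {dyadicCell j y, dyadicCell j y + 1} := by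
    intro a ha
    rw [Finset.mem_filter] at ha
    simp only [Finset.mem_insert, Finset.mem_singleton]
    omega
  exact_mod_cast (Finset.card_le_card h).trans Finset.card_le_two

lemma sum_cellKernel_le (s : Fin D → ℕ) (y : Torus D) :
    ∑ k ∈ Fintype.piFinset fun i => Finset.range (2 ^ s i),
      cellKernel s (fun i => 2 * (k i / 2)) y ≤ ∏ i, (2 * ((2 : ℝ) ^ s i / (2 * π))) := by
  unfold cellKernel
  rw [← Finset.prod_univ_sum (fun i => Finset.range (2 ^ s i))
    (fun i a => dyadicKernel (s i) (2 * (a / 2)) (y i))]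
  exact Finset.prod_le_prod
    (fun _ _ => Finset.sum_nonneg fun _ _ => dyadicKernel_nonneg _ _ _)
    fun _ _ => sum_dyadicKernel_le _ _

lemma sum_norm_haarCoeff_rpow_le {f : Torus D → ℂ} (hf : Integrable f) (s : Fin D → ℕ) {p : ℝ}
    (hp : 1 ≤ p) (hΔ : Integrable (mixedDiff (levelSupport s) (levelIncrement s) f))
    (hΔp : Integrable fun y => ‖mixedDiff (levelSupport s) (levelIncrement s) f y‖ ^ p) :
    ∑ k ∈ Fintype.piFinset fun i => Finset.range (2 ^ s i), ‖haarCoeff f s k‖ ^ p ≤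
      (∏ i, (2 * ((2 : ℝ) ^ s i / (2 * π)))) *
        ∫ y, ‖mixedDiff (levelSupport s) (levelIncrement s) f y‖ ^ p := by
  set g := mixedDiff (levelSupport s) (levelIncrement s) f with hg
  have hk : ∀ k ∈ Fintype.piFinset fun i => Finset.range (2 ^ s i), ‖haarCoeff f s k‖ ^ p ≤
      ∫ y, cellKernel s (fun i => 2 * (k i / 2)) y * ‖g y‖ ^ p := by
    intro k hk
    have hk' : ∀ i, k i < 2 ^ s i := fun i => Finset.mem_range.1 (Fintype.mem_piFinset.1 hk i)
    obtain ⟨σ, hσ, hσk⟩ := haarCoeff_eq hf hk'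
    refine le_trans ?_ (rpow_integral_cellKernel_le (b := fun i => 2 * (k i / 2))
      (fun i => (Nat.mul_div_le _ _).trans_lt (hk' i)) hp (fun y => norm_nonneg (g y)) hΔ.norm hΔp)
    refine rpow_le_rpow (norm_nonneg _) ?_ (by linarith)
    rw [hσk, norm_smul, Real.norm_eq_abs]
    refine (mul_le_of_le_one_left (norm_nonneg _) hσ).trans ?_
    refine (norm_integral_le_integral_norm _).trans (le_of_eq ?_)
    congr 1
    funext y
    rw [norm_smul, Real.norm_of_nonneg (cellKernel_nonneg _ _ _)]
  have h_int : ∀ k : Fin D → ℕ,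
      Integrable fun y => cellKernel s (fun i => 2 * (k i / 2)) y * ‖g y‖ ^ p := fun k =>
    integrable_cellKernel_smul s _ hΔp
  refine (Finset.sum_le_sum hk).trans ?_
  rw [← integral_finsetSum _ fun k _ => h_int k, ← integral_const_mul]
  refine integral_mono (integrable_finsetSum _ fun k _ => h_int k) (hΔp.const_mul _) fun y => ?_
  dsimp only
  rw [← Finset.sum_mul]
  exact mul_le_mul_of_nonneg_right (sum_cellKernel_le s y) (by positivity)

end

section

variable {D : ℕ}

/-- The average of `f` over the dyadic cube of level `N` containing `x`. -/
def cellAverage (f : Torus D → ℂ) (N : ℕ) (x : Torus D) : ℂ :=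
  ∫ y, cellKernel (fun _ => N) (fun i => dyadicCell N (x i)) y • f y

lemma abs_haarKernel_le (j a : ℕ) (y : AddCircle (2 * π)) :
    |haarKernel j a y| ≤ 2 ^ j / (2 * π) := by
  cases j with
  | zero =>
    rw [haarKernel, abs_of_nonneg (dyadicKernel_nonneg _ _ _)]
    exact dyadicKernel_le _ _ _
  | succ j =>
    have h1 := dyadicKernel_nonneg (j + 1) a y
    have h2 := dyadicKernel_le (j + 1) a y
    have h3 := dyadicKernel_nonneg j (a / 2) y
    have h4 := dyadicKernel_le j (a / 2) y
    have h5 : (2 : ℝ) ^ j / (2 * π) ≤ 2 ^ (j + 1) / (2 * π) := by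
      gcongr
      · exact one_le_two
      · exact Nat.le_succ j
    rw [haarKernel, abs_le]
    constructor <;> linarith

lemma measurable_haarKernel (j a : ℕ) : Measurable (haarKernel j a) := by
  cases j with
  | zero => exact measurable_dyadicKernel 0 a
  | succ j => exact (measurable_dyadicKernel (j + 1) a).sub (measurable_dyadicKernel j (a / 2))

lemma sum_haarCoeff {f : Torus D → ℂ} (hf : Integrable f) (N : ℕ) (x : Torus D) :
    ∑ s ∈ Fintype.piFinset fun _ => Finset.range (N + 1),
      haarCoeff f s (fun i => dyadicCell (s i) (x i)) = cellAverage f N x := by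
  have h_int : ∀ s : Fin D → ℕ, Integrable fun y : Torus D =>
      (∏ i, haarKernel (s i) (dyadicCell (s i) (x i)) (y i)) • f y := fun s => by
    have hm : Measurable fun y : Torus D =>
        ∏ i, haarKernel (s i) (dyadicCell (s i) (x i)) (y i) :=
      Finset.measurable_prod _ fun i _ =>
        (measurable_haarKernel (s i) (dyadicCell (s i) (x i))).comp (measurable_pi_apply i)
    have hb : ∀ y : Torus D, ‖∏ i, haarKernel (s i) (dyadicCell (s i) (x i)) (y i)‖ ≤
        ∏ i, ((2 : ℝ) ^ s i / (2 * π)) := fun y => by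
      rw [Real.norm_eq_abs, Finset.abs_prod]
      exact Finset.prod_le_prod (fun _ _ => abs_nonneg _) fun _ _ => abs_haarKernel_le _ _ _
    exact hf.bdd_smul _ hm.aestronglyMeasurable (.of_forall hb)
  unfold haarCoeff cellAverage
  rw [← integral_finsetSum _ fun s _ => h_int s]
  congr 1
  funext y
  rw [← Finset.sum_smul, ← Finset.prod_univ_sum (fun _ => Finset.range (N + 1))
    (fun i j => haarKernel j (dyadicCell j (x i)) (y i))]
  simp only [sum_haarKernel]
  rfl

lemma cellKernel_dyadicCell_comm (N : ℕ) (x y : Torus D) :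
    cellKernel (fun _ => N) (fun i => dyadicCell N (x i)) y =
      cellKernel (fun _ => N) (fun i => dyadicCell N (y i)) x :=
  Finset.prod_congr rfl fun i _ => by
    simp only [dyadicKernel, eq_comm (a := dyadicCell N (x i))]

lemma integrable_prod_cellKernel_smul {E : Type*} [NormedAddCommGroup E] [NormedSpace ℝ E] (N : ℕ)
    {f : Torus D → E} (hf : Integrable f) :
    Integrable (fun z : Torus D × Torus D =>
      cellKernel (fun _ => N) (fun i => dyadicCell N (z.1 i)) z.2 • f z.2)
      (volume.prod volume) := by
  refine (hf.comp_snd volume).bdd_smul (∏ _i : Fin D, ((2 : ℝ) ^ N / (2 * π))) ?_ ?_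
  · refine (Finset.measurable_prod _ fun i _ => ?_).aestronglyMeasurable
    refine Measurable.ite (measurableSet_eq_fun ?_ ?_) measurable_const measurable_const
    · exact (measurable_dyadicCell N).comp ((measurable_pi_apply i).comp measurable_snd)
    · exact (measurable_dyadicCell N).comp ((measurable_pi_apply i).comp measurable_fst)
  · refine .of_forall fun z => ?_
    rw [Real.norm_of_nonneg (cellKernel_nonneg _ _ _)]
    exact cellKernel_le _ _ _

lemma integrable_cellAverage {f : Torus D → ℂ} (hf : Integrable f) (N : ℕ) :
    Integrable (cellAverage f N) :=
  (integrable_prod_cellKernel_smul N hf).integral_prod_left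

lemma norm_cellAverage_le (f : Torus D → ℂ) (N : ℕ) (x : Torus D) :
    ‖cellAverage f N x‖ ≤
      ∫ y, cellKernel (fun _ => N) (fun i => dyadicCell N (x i)) y • ‖f y‖ := by
  refine (norm_integral_le_integral_norm _).trans (le_of_eq ?_)
  congr 1
  funext y
  rw [norm_smul, Real.norm_of_nonneg (cellKernel_nonneg _ _ _), smul_eq_mul]

lemma integral_norm_cellAverage_le {f : Torus D → ℂ} (hf : Integrable f) (N : ℕ) :
    ∫ x, ‖cellAverage f N x‖ ≤ ∫ x, ‖f x‖ := by
  have hprod : Integrable (Function.uncurry fun x y : Torus D =>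
      cellKernel (fun _ => N) (fun i => dyadicCell N (x i)) y • ‖f y‖) (volume.prod volume) :=
    integrable_prod_cellKernel_smul N hf.norm
  have hinner : ∀ y : Torus D,
      ∫ x : Torus D, cellKernel (fun _ => N) (fun i => dyadicCell N (x i)) y • ‖f y‖ =
        ‖f y‖ := fun y => by
    rw [integral_smul_const]
    have hcomm : (fun x : Torus D => cellKernel (fun _ => N) (fun i => dyadicCell N (x i)) y) =
        cellKernel (fun _ => N) (fun i => dyadicCell N (y i)) :=
      funext fun x => cellKernel_dyadicCell_comm N x y
    rw [hcomm, integral_cellKernel fun i => dyadicCell_lt _ _, one_smul]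
  have hswap := integral_integral_swap hprod
  simp only [hinner] at hswap
  rw [← hswap]
  exact integral_mono (integrable_cellAverage hf N).norm hprod.integral_prod_left
    (norm_cellAverage_le f N)

lemma cellAverage_sub {f g : Torus D → ℂ} (hf : Integrable f) (hg : Integrable g) (N : ℕ)
    (x : Torus D) :
    cellAverage (fun y => f y - g y) N x = cellAverage f N x - cellAverage g N x := by
  unfold cellAverage
  rw [← integral_sub (integrable_cellKernel_smul _ _ hf) (integrable_cellKernel_smul _ _ hg)]
  simp only [smul_sub]

lemma dist_le_of_dyadicCell_eq {N : ℕ} {x y : AddCircle (2 * π)}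
    (h : dyadicCell N x = dyadicCell N y) : dist x y ≤ 2 * π / 2 ^ N := by
  have hN : (0 : ℝ) < 2 ^ N := by positivity
  have hx := Nat.floor_le (mul_nonneg hN.le (unitCoord_nonneg x))
  have hx' := Nat.lt_floor_add_one ((2 : ℝ) ^ N * unitCoord x)
  have hy := Nat.floor_le (mul_nonneg hN.le (unitCoord_nonneg y))
  have hy' := Nat.lt_floor_add_one ((2 : ℝ) ^ N * unitCoord y)
  unfold dyadicCell at h
  rw [h] at hx hx'
  rw [← coe_unitCoord x, ← coe_unitCoord y, dist_eq_norm, ← AddCircle.coe_sub, ← mul_sub]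
  refine (QuotientAddGroup.norm_mk_le_norm).trans ?_
  rw [Real.norm_eq_abs, abs_mul, abs_of_pos (by positivity : (0 : ℝ) < 2 * π), div_eq_mul_inv]
  refine mul_le_mul_of_nonneg_left ?_ (by positivity)
  rw [← one_div, le_div_iff₀ hN, ← abs_of_pos hN, ← abs_mul, abs_le]
  constructor <;> nlinarith

lemma tendsto_cellAverage_of_continuous {g : Torus D → ℂ} (hg : Continuous g) {ε : ℝ}
    (hε : 0 < ε) : ∃ N₀ : ℕ, ∀ N ≥ N₀, ∀ x, ‖cellAverage g N x - g x‖ ≤ ε := by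
  obtain ⟨δ, hδ, hgδ⟩ := Metric.uniformContinuous_iff.1
    (CompactSpace.uniformContinuous_of_continuous hg) ε hε
  obtain ⟨N₀, hN₀⟩ := exists_pow_lt_of_lt_one (div_pos hδ (by positivity : 0 < 2 * π))
    (by norm_num : (1 / 2 : ℝ) < 1)
  have hgi : Integrable g :=
    hg.integrable_of_hasCompactSupport (HasCompactSupport.of_compactSpace g)
  refine ⟨N₀, fun N hN x => ?_⟩
  have hone : ∫ y, cellKernel (fun _ => N) (fun i => dyadicCell N (x i)) y = 1 :=
    integral_cellKernel fun i => dyadicCell_lt _ _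
  have hgx : g x = cellAverage (fun _ => g x) N x := by
    unfold cellAverage
    rw [integral_smul_const, hone, one_smul]
  have hsmall : 2 * π / 2 ^ N < δ := by
    rw [lt_div_iff₀ (by positivity)] at hN₀
    refine lt_of_le_of_lt ?_ hN₀
    rw [one_div, inv_pow, div_eq_mul_inv, mul_comm]
    gcongr
    exact one_le_two
  have hc : Integrable fun _ : Torus D => g x := integrable_const _
  conv_lhs => rw [hgx]
  rw [← cellAverage_sub hgi hc]
  refine (norm_cellAverage_le _ _ _).trans ?_
  calc ∫ y, cellKernel (fun _ => N) (fun i => dyadicCell N (x i)) y • ‖g y - g x‖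
      ≤ ∫ y, cellKernel (fun _ => N) (fun i => dyadicCell N (x i)) y • ε := by
        refine integral_mono (integrable_cellKernel_smul _ _ (hgi.sub hc).norm)
          (integrable_cellKernel_smul _ _ (integrable_const _)) fun y => ?_
        dsimp only
        by_cases h : ∀ i, dyadicCell N (y i) = dyadicCell N (x i)
        · refine smul_le_smul_of_nonneg_left ?_ (cellKernel_nonneg _ _ _)
          rw [← dist_eq_norm]
          refine (hgδ (lt_of_le_of_lt ?_ hsmall)).le
          exact (dist_pi_le_iff (by positivity)).2 fun i => dist_le_of_dyadicCell_eq (h i)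
        · obtain ⟨i, hi⟩ := not_forall.1 h
          have : cellKernel (fun _ => N) (fun i => dyadicCell N (x i)) y = 0 :=
            Finset.prod_eq_zero (Finset.mem_univ i) (if_neg hi)
          rw [this, zero_smul, zero_smul]
    _ = ε := by rw [integral_smul_const, hone, one_smul]

lemma tendsto_integral_norm_cellAverage_sub {f : Torus D → ℂ} (hf : Integrable f) {ε : ℝ}
    (hε : 0 < ε) : ∃ N₀ : ℕ, ∀ N ≥ N₀, ∫ x, ‖f x - cellAverage f N x‖ ≤ ε := by
  obtain ⟨g, hfg, hg⟩ := hf.exists_boundedContinuous_integral_sub_le (by positivity : 0 < ε / 3)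
  set V := volume.real (Set.univ : Set (Torus D)) with hV
  have hV0 : 0 ≤ V := measureReal_nonneg
  obtain ⟨N₀, hN₀⟩ := tendsto_cellAverage_of_continuous g.continuous
    (by positivity : 0 < ε / (3 * (V + 1)))
  refine ⟨N₀, fun N hN => ?_⟩
  have hfgi : Integrable fun y => f y - g y := hf.sub hg
  have havg := integrable_cellAverage hfgi N
  calc ∫ x, ‖f x - cellAverage f N x‖
      ≤ ∫ x, (‖f x - g x‖ + ‖cellAverage (fun y => f y - g y) N x‖ + ε / (3 * (V + 1))) := by
        refine integral_mono (hf.sub (integrable_cellAverage hf N)).norm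
          ((hfgi.norm.add havg.norm).add (integrable_const _)) fun x => ?_
        dsimp only
        have h1 := hN₀ N hN x
        have h2 : f x - cellAverage f N x = (f x - g x) - cellAverage (fun y => f y - g y) N x -
            (cellAverage g N x - g x) := by
          rw [cellAverage_sub hf hg]; ring
        rw [h2]
        refine (norm_sub_le _ _).trans (add_le_add (norm_sub_le _ _) h1)
    _ = (∫ x, ‖f x - g x‖) + (∫ x, ‖cellAverage (fun y => f y - g y) N x‖) +
          V * (ε / (3 * (V + 1))) := by
        have hadd : Integrable fun x =>
          ‖f x - g x‖ + ‖cellAverage (fun y => f y - g y) N x‖ := hfgi.norm.add havg.norm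
        rw [integral_add hadd (integrable_const _), integral_add hfgi.norm havg.norm,
          integral_const, smul_eq_mul]
    _ ≤ ε / 3 + ε / 3 + ε / 3 := by
        refine add_le_add (add_le_add hfg ((integral_norm_cellAverage_le hfgi N).trans hfg)) ?_
        rw [mul_div_assoc', div_le_div_iff₀ (by positivity) (by positivity)]
        nlinarith
    _ = ε := by ring

lemma ae_norm_sub_cellAverage_le {f : Torus D → ℂ} (hf : Integrable f) {N : ℕ} {T : ℝ}
    (hT : ∀ N' ≥ N, ∀ x, ‖cellAverage f N' x - cellAverage f N x‖ ≤ T) :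
    ∀ᵐ x, ‖f x - cellAverage f N x‖ ≤ T := by
  set φ : Torus D → ℝ := fun x => max (‖f x - cellAverage f N x‖ - T) 0 with hφ
  have hφi : Integrable φ := (((hf.sub (integrable_cellAverage hf N)).norm).sub
    (integrable_const T)).pos_part
  have hφ0 : 0 ≤ φ := fun x => le_max_right _ _
  have hle : ∫ x, φ x ≤ 0 := by
    refine le_of_forall_pos_le_add fun ε hε => ?_
    obtain ⟨N₀, hN₀⟩ := tendsto_integral_norm_cellAverage_sub hf hε
    rw [zero_add]
    refine le_trans ?_ (hN₀ (max N N₀) (le_max_right _ _))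
    refine integral_mono hφi (hf.sub (integrable_cellAverage hf _)).norm fun x => ?_
    refine max_le ?_ (norm_nonneg _)
    have h1 := hT (max N N₀) (le_max_left _ _) x
    have h2 := norm_add_le (f x - cellAverage f (max N N₀) x)
      (cellAverage f (max N N₀) x - cellAverage f N x)
    rw [sub_add_sub_cancel] at h2
    linarith
  have hzero := (integral_eq_zero_iff_of_nonneg hφ0 hφi).1
    (le_antisymm hle (integral_nonneg hφ0))
  filter_upwards [hzero] with x hx
  have : ‖f x - cellAverage f N x‖ - T ≤ φ x := le_max_left _ _
  rw [hx] at this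
  simpa using this

end

lemma sum_piFinset_range {D : ℕ} {M : Type*} [AddCommMonoid M] (n : Fin D → ℕ)
    (F : (Fin D → ℕ) → M) :
    ∑ k ∈ Fintype.piFinset fun i => Finset.range (n i), F k =
      ∑ k : ∀ i, Fin (n i), F fun i => k i := by
  symm
  refine Finset.sum_bij (fun k _ i => (k i : ℕ)) (fun k _ => ?_) (fun k _ k' _ h => ?_)
    (fun k hk => ?_) fun _ _ => rfl
  · exact Fintype.mem_piFinset.2 fun i => Finset.mem_range.2 (k i).2
  · funext i
    exact Fin.ext (congrFun h i)
  · exact ⟨fun i => ⟨k i, Finset.mem_range.1 (Fintype.mem_piFinset.1 hk i)⟩, Finset.mem_univ _, rfl⟩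

/-- Decay of the Haar coefficients at the rate of a mixed Hölder–Nikolskii class. -/
def HasHaarDecay {D : ℕ} (p r C₀ : ℝ) (f : Torus D → ℂ) : Prop :=
  Integrable f ∧ ∀ s : Fin D → ℕ,
    ∑ k ∈ Fintype.piFinset fun i => Finset.range (2 ^ s i), ‖haarCoeff f s k‖ ^ p ≤
      C₀ * (2 : ℝ) ^ ((1 - r * p) * ((∑ i, s i : ℕ) : ℝ))

lemma HasHaarDecay.norm_haarCoeff_le {D : ℕ} {p r C₀ : ℝ} {f : Torus D → ℂ}
    (h : HasHaarDecay p r C₀ f) (hp : 0 < p) (hC₀ : 0 < C₀) {s k : Fin D → ℕ}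
    (hk : ∀ i, k i < 2 ^ s i) :
    ‖haarCoeff f s k‖ ≤ C₀ ^ (1 / p) * (2 : ℝ) ^ (-((r - 1 / p) * ((∑ i, s i : ℕ) : ℝ))) := by
  have h1 : ‖haarCoeff f s k‖ ^ p ≤ C₀ * (2 : ℝ) ^ ((1 - r * p) * ((∑ i, s i : ℕ) : ℝ)) :=
    (Finset.single_le_sum (f := fun k => ‖haarCoeff f s k‖ ^ p) (fun _ _ => by positivity)
      (Fintype.mem_piFinset.2 fun i => Finset.mem_range.2 (hk i))).trans (h.2 s)
  have h2 := rpow_le_rpow (by positivity) h1 (by positivity : 0 ≤ 1 / p)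
  rw [← rpow_mul (norm_nonneg _), mul_one_div_cancel hp.ne', rpow_one,
    mul_rpow hC₀.le (by positivity), ← rpow_mul zero_le_two] at h2
  refine h2.trans (le_of_eq ?_)
  congr 2
  field_simp
  ring

lemma exists_sum_tail_le (d : ℕ) {r δ : ℝ} (hδ : 0 < δ) {K : ℕ} (hK : r ≤ K * (δ / 2)) :
    ∃ C : ℝ, 0 < C ∧ ∀ n₁ N N' : ℕ, N = K * (n₁ + 1) →
      ∑ s ∈ (Fintype.piFinset fun _ : Fin (d + 1) => Finset.range (N' + 1)) \
        Fintype.piFinset fun _ => Finset.range (N + 1),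
        (2 : ℝ) ^ (-(δ * ((∑ i, s i : ℕ) : ℝ))) ≤ C * (2 : ℝ) ^ (-(r * n₁)) := by
  set ρ : ℝ := (2 : ℝ) ^ (-(δ / 2)) with hρ
  have hρ0 : 0 < ρ := by positivity
  have hρ1 : ρ < 1 := rpow_lt_one_of_one_lt_of_neg one_lt_two (by linarith)
  have hsum := summable_poly_geometric d hρ0 hρ1
  have hρpow : ∀ k : ℕ, ρ ^ k = (2 : ℝ) ^ (-(δ / 2) * k) := fun k => by
    rw [hρ, ← rpow_natCast, ← rpow_mul zero_le_two]
  refine ⟨∑' k : ℕ, ((k : ℝ) + 1) ^ d * ρ ^ k + 1, ?_, fun n₁ N N' hN => ?_⟩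
  · have : 0 ≤ ∑' k : ℕ, ((k : ℝ) + 1) ^ d * ρ ^ k := tsum_nonneg fun k => by positivity
    linarith
  have hterm : ∀ s ∈ (Fintype.piFinset fun _ : Fin (d + 1) => Finset.range (N' + 1)) \
      Fintype.piFinset fun _ => Finset.range (N + 1),
      (2 : ℝ) ^ (-(δ * ((∑ i, s i : ℕ) : ℝ))) ≤ (2 : ℝ) ^ (-(r * n₁)) * ρ ^ (∑ i, s i) := by
    intro s hs
    rw [Finset.mem_sdiff, Fintype.mem_piFinset, Fintype.mem_piFinset, not_forall] at hs
    obtain ⟨-, i, hi⟩ := hs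
    rw [Finset.mem_range, not_lt] at hi
    have hle : K * n₁ ≤ ∑ i, s i := by
      refine le_trans ?_ (Finset.single_le_sum (f := s) (fun _ _ => Nat.zero_le _)
        (Finset.mem_univ i))
      rw [hN] at hi
      nlinarith
    rw [hρpow, ← rpow_add zero_lt_two]
    refine rpow_le_rpow_of_exponent_le one_le_two ?_
    have hle' : (K : ℝ) * n₁ ≤ ((∑ i, s i : ℕ) : ℝ) := by exact_mod_cast hle
    have h1 : r * n₁ ≤ K * (δ / 2) * n₁ := mul_le_mul_of_nonneg_right hK (Nat.cast_nonneg _)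
    have h2 : δ / 2 * (K * n₁) ≤ δ / 2 * ((∑ i, s i : ℕ) : ℝ) :=
      mul_le_mul_of_nonneg_left hle' (by positivity)
    linarith
  refine (Finset.sum_le_sum hterm).trans ?_
  rw [← Finset.mul_sum, mul_comm]
  refine mul_le_mul_of_nonneg_right ?_ (by positivity)
  refine (Finset.sum_le_sum_of_subset_of_nonneg Finset.sdiff_subset
    fun _ _ _ => by positivity).trans ?_
  rw [sum_piFinset_range (fun _ => N' + 1) fun s => ρ ^ (∑ i, s i)]
  refine (sum_level_le N' (F := fun n => ρ ^ n) fun n => by positivity).trans ?_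
  have := hsum.sum_le_tsum (Finset.range ((d + 1) * N' + 1)) fun k _ => by positivity
  linarith

lemma HasHaarDecay.norm_cellAverage_sub_le {D : ℕ} {p r C₀ : ℝ} {f : Torus D → ℂ}
    (h : HasHaarDecay p r C₀ f) (hp : 0 < p) (hC₀ : 0 < C₀) {N N' : ℕ} (hN : N ≤ N')
    (x : Torus D) :
    ‖cellAverage f N' x - cellAverage f N x‖ ≤ C₀ ^ (1 / p) *
      ∑ s ∈ (Fintype.piFinset fun _ : Fin D => Finset.range (N' + 1)) \
        Fintype.piFinset fun _ => Finset.range (N + 1),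
        (2 : ℝ) ^ (-((r - 1 / p) * ((∑ i, s i : ℕ) : ℝ))) := by
  rw [← sum_haarCoeff h.1, ← sum_haarCoeff h.1, ← Finset.sum_sdiff_eq_sub, Finset.mul_sum]
  · exact (norm_sum_le _ _).trans (Finset.sum_le_sum fun s _ =>
      h.norm_haarCoeff_le hp hC₀ fun i => dyadicCell_lt _ _)
  · exact Fintype.piFinset_subset _ _ fun _ => Finset.range_subset_range.2 (by omega)

lemma exists_level_bound (d : ℕ) {r : ℝ} (hr : 0 < r) :
    ∃ C : ℝ, 0 < C ∧ ∀ m : ℕ, 2 ≤ m → ∃ n₁ : ℕ, 2 ^ n₁ * (n₁ + 1) ≤ m ∧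
      ((n₁ : ℝ) + 1) ^ d * (2 : ℝ) ^ (-(r * n₁)) ≤
        C * ((m : ℝ) ^ (-r) * log m ^ ((d : ℝ) + r)) := by
  have hlog2 : 0 < log 2 := log_pos one_lt_two
  refine ⟨4 ^ r * (2 / log 2) ^ ((d : ℝ) + r), by positivity, fun m hm => ?_⟩
  set P : ℕ → Prop := fun n => 2 ^ n * (n + 1) ≤ m with hP
  set n₁ := Nat.findGreatest P m with hn
  have h1 : P n₁ := Nat.findGreatest_spec (P := P) (Nat.zero_le m) (by simp [hP]; omega)
  have h2 : m < 2 ^ (n₁ + 1) * (n₁ + 1 + 1) := by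
    by_contra! hcon
    have hlt : n₁ + 1 ≤ m := by
      have := Nat.one_le_two_pow (n := n₁ + 1)
      nlinarith
    exact Nat.findGreatest_is_greatest (P := P) (Nat.lt_succ_self n₁) hlt hcon
  refine ⟨n₁, h1, ?_⟩
  have hm0 : (0 : ℝ) < m := by exact_mod_cast (by omega : 0 < m)
  have hn1 : (0 : ℝ) < (n₁ : ℝ) + 1 := by positivity
  have hlogm : log 2 ≤ log m := log_le_log zero_lt_two (by exact_mod_cast hm)
  have h3 : (n₁ : ℝ) + 1 ≤ 2 / log 2 * log m := by
    have h4 : (2 : ℝ) ^ n₁ ≤ m := by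
      have : 2 ^ n₁ ≤ m := le_trans (Nat.le_mul_of_pos_right _ (Nat.succ_pos _)) h1
      exact_mod_cast this
    have h5 := log_le_log (by positivity) h4
    rw [log_pow] at h5
    rw [div_mul_eq_mul_div, le_div_iff₀ hlog2]
    linarith
  have h6 : (2 : ℝ) ^ (-(n₁ : ℝ)) ≤ 4 * ((n₁ : ℝ) + 1) / m := by
    rw [rpow_neg zero_le_two, rpow_natCast, ← one_div, div_le_div_iff₀ (by positivity) hm0]
    have h7 : (m : ℝ) ≤ 2 ^ (n₁ + 1) * (n₁ + 1 + 1) := by exact_mod_cast h2.le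
    rw [pow_succ] at h7
    have : (0 : ℝ) ≤ n₁ * 2 ^ n₁ := by positivity
    nlinarith
  have h8 : (2 : ℝ) ^ (-(r * n₁)) ≤ 4 ^ r * ((n₁ : ℝ) + 1) ^ r * (m : ℝ) ^ (-r) := by
    have := rpow_le_rpow (by positivity) h6 hr.le
    rw [← rpow_mul zero_le_two, div_rpow (by positivity) hm0.le, mul_rpow (by norm_num) hn1.le,
      div_eq_mul_inv, ← rpow_neg hm0.le] at this
    rwa [neg_mul, mul_comm (n₁ : ℝ)] at this
  calc ((n₁ : ℝ) + 1) ^ d * (2 : ℝ) ^ (-(r * n₁))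
      ≤ ((n₁ : ℝ) + 1) ^ d * (4 ^ r * ((n₁ : ℝ) + 1) ^ r * (m : ℝ) ^ (-r)) := by gcongr
    _ = 4 ^ r * ((n₁ : ℝ) + 1) ^ ((d : ℝ) + r) * (m : ℝ) ^ (-r) := by
      rw [rpow_add hn1, rpow_natCast]; ring
    _ ≤ 4 ^ r * (2 / log 2 * log m) ^ ((d : ℝ) + r) * (m : ℝ) ^ (-r) := by gcongr
    _ = _ := by rw [mul_rpow (by positivity) (by linarith)]; ring

/-- The dyadic subcube of side length `2π / 2 ^ N` containing a point. -/
def dyadicIndex {D : ℕ} (N : ℕ) (x : Torus D) : Fin D → Fin (2 ^ N) :=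
  fun i => ⟨dyadicCell N (x i), dyadicCell_lt N (x i)⟩

lemma measurable_dyadicIndex {D : ℕ} (N : ℕ) :
    Measurable (dyadicIndex N : Torus D → Fin D → Fin (2 ^ N)) := by
  refine measurable_pi_lambda _ fun i => ?_
  have hm : Measurable fun x : Torus D => dyadicCell N (x i) :=
    (measurable_dyadicCell N).comp (measurable_pi_apply i)
  refine measurable_to_countable' fun k => ?_
  have : (fun x : Torus D => dyadicIndex N x i) ⁻¹' {k} =
      (fun x : Torus D => dyadicCell N (x i)) ⁻¹' {(k : ℕ)} := by
    ext x
    simp [dyadicIndex, Fin.ext_iff]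
  exact this ▸ hm (measurableSet_singleton _)

/-- The index of the dyadic box of level `s` containing a subcube of level `N`. -/
def coarsen {D N : ℕ} (s : Fin D → Fin (N + 1)) (x : Fin D → Fin (2 ^ N)) :
    ∀ i, Fin (2 ^ (s i : ℕ)) := fun i =>
  ⟨x i / 2 ^ (N - s i), by
    rw [Nat.div_lt_iff_lt_mul (by positivity), ← pow_add,
      Nat.add_sub_cancel' (Nat.lt_succ_iff.1 (s i).2)]
    exact (x i).2⟩

lemma coarsen_dyadicIndex {D N : ℕ} (s : Fin D → Fin (N + 1)) (x : Torus D) (i : Fin D) :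
    (coarsen s (dyadicIndex N x) i : ℕ) = dyadicCell (s i) (x i) := by
  have h := dyadicCell_div (s i) (N - s i) (x i)
  rwa [Nat.add_sub_cancel' (Nat.lt_succ_iff.1 (s i).2)] at h

lemma exists_subspace_haarDecay (d : ℕ) {p r : ℝ} (hp : 2 < p) (hrp : 1 / p < r)
    (hr : r < 1 / 2) {C₀ : ℝ} (hC₀ : 0 < C₀) :
    ∃ C : ℝ, 0 < C ∧ ∀ m : ℕ, 2 ≤ m → ∃ N : ℕ,
      ∃ W : Submodule ℂ ((Fin (d + 1) → Fin (2 ^ N)) → ℂ), Module.finrank ℂ W < m ∧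
        ∀ f : Torus (d + 1) → ℂ, HasHaarDecay p r C₀ f →
          ∃ b ∈ W, ∀ᵐ x, ‖f x - b (dyadicIndex N x)‖ ≤
            C * ((m : ℝ) ^ (-r) * log m ^ ((d : ℝ) + r)) := by
  have hp0 : 0 < p := by linarith
  have hr0 : 0 < r := lt_trans (by positivity) hrp
  have hδ : 0 < r - 1 / p := sub_pos.2 hrp
  obtain ⟨K, hK⟩ := exists_nat_ge (r / ((r - 1 / p) / 2))
  rw [div_le_iff₀ (by positivity)] at hK
  obtain ⟨C₁, hC₁, h₁⟩ := exists_subspace_discrete_class d hp hrp hr hC₀ K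
  obtain ⟨C₂, hC₂, h₂⟩ := exists_sum_tail_le d hδ hK
  obtain ⟨C₃, hC₃, h₃⟩ := exists_level_bound d hr0
  refine ⟨(C₁ + C₀ ^ (1 / p) * C₂) * C₃, by positivity, fun m hm => ?_⟩
  obtain ⟨n₁, hn₁, hbd⟩ := h₃ m hm
  set N := K * (n₁ + 1) with hN
  obtain ⟨W, hW, happ⟩ := h₁ (m - 1) n₁ (by omega) (by omega) N hN coarsen
  refine ⟨N, W, by omega, fun f hf => ?_⟩
  obtain ⟨b, hb, hbx⟩ := happ (fun s k => haarCoeff f (fun i => s i) fun i => k i) fun s => by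
    have := hf.2 fun i => s i
    rwa [sum_piFinset_range (fun i => 2 ^ (s i : ℕ))
      fun k => ‖haarCoeff f (fun i => s i) k‖ ^ p] at this
  refine ⟨b, hb, ?_⟩
  have htail : ∀ N' ≥ N, ∀ x, ‖cellAverage f N' x - cellAverage f N x‖ ≤
      C₀ ^ (1 / p) * (C₂ * (2 : ℝ) ^ (-(r * n₁))) := fun N' hN' x =>
    (hf.norm_cellAverage_sub_le hp0 hC₀ hN' x).trans
      (mul_le_mul_of_nonneg_left (h₂ n₁ N N' hN) (by positivity))
  filter_upwards [ae_norm_sub_cellAverage_le hf.1 htail] with x hx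
  have hdisc : ‖cellAverage f N x - b (dyadicIndex N x)‖ ≤
      C₁ * ((n₁ : ℝ) + 1) ^ d * (2 : ℝ) ^ (-(r * n₁)) := by
    have h := hbx (dyadicIndex N x)
    simp only [coarsen_dyadicIndex] at h
    rwa [← sum_piFinset_range (fun _ => N + 1)
      fun s => haarCoeff f s fun i => dyadicCell (s i) (x i), sum_haarCoeff hf.1] at h
  have hone : (2 : ℝ) ^ (-(r * n₁)) ≤ ((n₁ : ℝ) + 1) ^ d * (2 : ℝ) ^ (-(r * n₁)) :=
    le_mul_of_one_le_left (by positivity)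
      (one_le_pow₀ (le_add_of_nonneg_left (Nat.cast_nonneg _)))
  calc ‖f x - b (dyadicIndex N x)‖
      ≤ ‖f x - cellAverage f N x‖ + ‖cellAverage f N x - b (dyadicIndex N x)‖ :=
        norm_sub_le_norm_sub_add_norm_sub _ _ _
    _ ≤ C₀ ^ (1 / p) * (C₂ * (((n₁ : ℝ) + 1) ^ d * (2 : ℝ) ^ (-(r * n₁)))) +
        C₁ * ((n₁ : ℝ) + 1) ^ d * (2 : ℝ) ^ (-(r * n₁)) := by
        refine add_le_add (hx.trans ?_) hdisc
        gcongr
    _ = (C₁ + C₀ ^ (1 / p) * C₂) * (((n₁ : ℝ) + 1) ^ d * (2 : ℝ) ^ (-(r * n₁))) := by ring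
    _ ≤ (C₁ + C₀ ^ (1 / p) * C₂) * (C₃ * ((m : ℝ) ^ (-r) * log m ^ ((d : ℝ) + r))) := by
        gcongr
    _ = _ := by ring

lemma memLp_mixedDiff {D : ℕ} {q : ℝ≥0∞} {f : Torus D → ℂ} (hf : MemLp f q)
    (e : Finset (Fin D)) (h : Fin D → ℝ) : MemLp (mixedDiff e h f) q :=
  memLp_finsetSum _ fun _ _ =>
    (hf.comp_measurePreserving (measurePreserving_add_right volume _)).const_mul _

lemma levelIncrement_mem_increments {D : ℕ} (s : Fin D → ℕ) :
    levelIncrement s ∈ Increments D := by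
  intro i
  have hπ := pi_pos
  by_cases hi : s i = 0
  · simp only [levelIncrement, hi, ne_eq, not_true_eq_false, if_false, Set.mem_Ioo]
    exact ⟨hπ, by linarith⟩
  · simp only [levelIncrement, hi, ne_eq, not_false_eq_true, if_true, Set.mem_Ioo]
    exact ⟨by positivity, div_lt_self (by positivity) (one_lt_pow₀ one_lt_two hi)⟩

lemma prod_levelIncrement_rpow_le {D : ℕ} (s : Fin D → ℕ) {r : ℝ} (hr : 0 < r) :
    ∏ i ∈ levelSupport s, |levelIncrement s i| ^ r ≤
      ((2 * π) ^ r) ^ D * (2 : ℝ) ^ (-(r * ((∑ i, s i : ℕ) : ℝ))) := by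
  have hπ : 1 ≤ (2 * π) ^ r := one_le_rpow (by linarith [pi_gt_three]) hr.le
  have hfac : ∏ i, ((2 * π) ^ r * (2 : ℝ) ^ (-(r * (s i : ℝ)))) =
      ((2 * π) ^ r) ^ D * (2 : ℝ) ^ (-(r * ((∑ i, s i : ℕ) : ℝ))) := by
    rw [Finset.prod_mul_distrib, Finset.prod_const, Finset.card_univ, Fintype.card_fin,
      ← rpow_sum_of_pos zero_lt_two, Finset.sum_neg_distrib, ← Finset.mul_sum, Nat.cast_sum]
  rw [← hfac, levelSupport, Finset.prod_filter]
  refine Finset.prod_le_prod (fun i _ => by split_ifs <;> positivity) fun i _ => ?_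
  by_cases hi : s i = 0
  · simpa [hi] using hπ
  · rw [if_pos hi, levelIncrement, if_pos hi, abs_of_pos (by positivity),
      div_rpow (by positivity) (by positivity), ← rpow_natCast, ← rpow_mul zero_le_two,
      div_eq_mul_inv, ← rpow_neg zero_le_two, mul_comm (s i : ℝ)]

lemma prod_level_le {D : ℕ} (s : Fin D → ℕ) :
    ∏ i, (2 * ((2 : ℝ) ^ s i / (2 * π))) ≤ (2 : ℝ) ^ (((∑ i, s i : ℕ) : ℝ)) := by
  rw [rpow_natCast, ← Finset.prod_pow_eq_pow_sum]
  refine Finset.prod_le_prod (fun i _ => by positivity) fun i _ => ?_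
  rw [mul_div_assoc', mul_div_mul_left _ _ two_ne_zero]
  exact div_le_self (by positivity) (by linarith [pi_gt_three])

lemma exists_real_exponent {q : ℝ≥0∞} (hq : 2 < q) {r : ℝ} (hrp : (q⁻¹).toReal < r) :
    ∃ p : ℝ, 2 < p ∧ 1 / p < r ∧ ENNReal.ofReal p ≤ q := by
  rcases eq_or_ne q ∞ with rfl | hq'
  · have hr : 0 < r := by simpa using hrp
    refine ⟨max 3 (2 / r), by norm_num, ?_, le_top⟩
    rw [one_div_lt (by positivity) hr]
    refine lt_max_of_lt_right ?_
    gcongr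
    norm_num
  · refine ⟨q.toReal, ?_, ?_, ENNReal.ofReal_toReal_le⟩
    · rw [← ENNReal.toReal_ofNat 2]
      exact (ENNReal.toReal_lt_toReal (by simp) hq').2 hq
    · rwa [one_div, ← ENNReal.toReal_inv]

lemma exists_hasHaarDecay (D : ℕ) {q : ℝ≥0∞} {p r : ℝ} (hp : 1 ≤ p) (hpq : ENNReal.ofReal p ≤ q)
    (hr : 0 < r) :
    ∃ C₀ : ℝ, 0 < C₀ ∧ ∀ f : Torus D → ℂ, MemLp f ∞ →
      (∀ e : Finset (Fin D), ∀ h ∈ Increments D, holderTerm D r q f e h ≤ 1) →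
        HasHaarDecay p r C₀ f := by
  have hp0 : 0 < p := by linarith
  set V : ℝ := ((volume : Measure (Torus D)) Set.univ ^
    (1 / (ENNReal.ofReal p).toReal - 1 / q.toReal)).toReal with hV
  have hVne : (volume : Measure (Torus D)) Set.univ ^
      (1 / (ENNReal.ofReal p).toReal - 1 / q.toReal) ≠ ∞ :=
    ENNReal.rpow_ne_top_of_ne_zero (by simp [NeZero.ne]) (measure_ne_top _ _)
  have hV0 : 0 ≤ V := ENNReal.toReal_nonneg
  refine ⟨(((2 * π) ^ r) ^ D * V) ^ p + 1, by positivity, fun f hf hfe => ?_⟩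
  have hf1 : Integrable f := memLp_one_iff_integrable.1 (hf.mono_exponent le_top)
  refine ⟨hf1, fun s => ?_⟩
  set g := mixedDiff (levelSupport s) (levelIncrement s) f with hg
  have hgtop : MemLp g ∞ := memLp_mixedDiff hf _ _
  have hgp : MemLp g (ENNReal.ofReal p) := hgtop.mono_exponent le_top
  have hgq : MemLp g q := hgtop.mono_exponent le_top
  have hp' : ENNReal.ofReal p ≠ 0 := by simpa using hp0
  have hnorm : (eLpNorm g q volume).toReal ≤
      ((2 * π) ^ r) ^ D * (2 : ℝ) ^ (-(r * ((∑ i, s i : ℕ) : ℝ))) := by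
    have h := hfe (levelSupport s) _ (levelIncrement_mem_increments s)
    have hpos : ∀ i, 0 < |levelIncrement s i| := fun i =>
      abs_pos.2 (levelIncrement_mem_increments s i).1.ne'
    refine le_trans ?_ (prod_levelIncrement_rpow_le s hr)
    rw [holderTerm, Finset.prod_congr rfl fun i _ => rpow_neg (hpos i).le r,
      Finset.prod_inv_distrib] at h
    rwa [inv_mul_le_iff₀ (Finset.prod_pos fun i _ => rpow_pos_of_pos (hpos i) r), mul_one] at h
  have h_int : ∫ y, ‖g y‖ ^ p = (eLpNorm g (ENNReal.ofReal p) volume).toReal ^ p := by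
    rw [hgp.eLpNorm_eq_integral_rpow_norm hp' ENNReal.ofReal_ne_top,
      ENNReal.toReal_ofReal hp0.le, ENNReal.toReal_ofReal (by positivity),
      ← rpow_mul (by positivity), inv_mul_cancel₀ hp0.ne', rpow_one]
  have hle : (eLpNorm g (ENNReal.ofReal p) volume).toReal ≤
      (eLpNorm g q volume).toReal * V := by
    rw [hV, ← ENNReal.toReal_mul]
    exact ENNReal.toReal_mono (ENNReal.mul_ne_top hgq.eLpNorm_ne_top hVne)
      (eLpNorm_le_eLpNorm_mul_rpow_measure_univ hpq hgtop.aestronglyMeasurable)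
  have hgpi : Integrable fun y => ‖g y‖ ^ p := by
    simpa [ENNReal.toReal_ofReal hp0.le] using hgp.integrable_norm_rpow hp' ENNReal.ofReal_ne_top
  refine (sum_norm_haarCoeff_rpow_le hf1 s hp
    (memLp_one_iff_integrable.1 (hgtop.mono_exponent le_top)) hgpi).trans ?_
  set n : ℝ := ((∑ i, s i : ℕ) : ℝ) with hn
  calc (∏ i, (2 * ((2 : ℝ) ^ s i / (2 * π)))) * ∫ y, ‖g y‖ ^ p
      ≤ (2 : ℝ) ^ n * (((2 * π) ^ r) ^ D * (2 : ℝ) ^ (-(r * n)) * V) ^ p := by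
        rw [h_int]
        refine mul_le_mul (prod_level_le s) ?_ (by positivity) (by positivity)
        exact rpow_le_rpow ENNReal.toReal_nonneg
          (hle.trans (mul_le_mul_of_nonneg_right hnorm hV0)) hp0.le
    _ = (((2 * π) ^ r) ^ D * V) ^ p * (2 : ℝ) ^ ((1 - r * p) * n) := by
        rw [mul_right_comm, mul_rpow (by positivity) (by positivity), ← rpow_mul zero_le_two,
          mul_left_comm, ← rpow_add zero_lt_two]
        congr 2
        ring
    _ ≤ _ := by gcongr; linarith

lemma memLp_stepFunction {D : ℕ} (N : ℕ) (b : (Fin D → Fin (2 ^ N)) → ℂ) :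
    MemLp (fun x : Torus D => b (dyadicIndex N x)) ∞ :=
  memLp_top_of_bound ((measurable_of_finite b).comp (measurable_dyadicIndex N)).aestronglyMeasurable
    (∑ k, ‖b k‖) <| Filter.Eventually.of_forall fun _ =>
      Finset.single_le_sum (f := fun k => ‖b k‖) (fun _ _ => norm_nonneg _) (Finset.mem_univ _)

/-- The function constant on dyadic subcubes with the given values, as a bounded function. -/
def stepLp {D : ℕ} (N : ℕ) :
    ((Fin D → Fin (2 ^ N)) → ℂ) →ₗ[ℂ] Lp ℂ ∞ (volume : Measure (Torus D)) where
  toFun b := (memLp_stepFunction N b).toLp fun x => b (dyadicIndex N x)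
  map_add' _ _ := rfl
  map_smul' _ _ := rfl

lemma norm_sub_stepLp_le {D N : ℕ} (f : Lp ℂ ∞ (volume : Measure (Torus D)))
    (b : (Fin D → Fin (2 ^ N)) → ℂ) {T : ℝ} (hT : 0 ≤ T)
    (h : ∀ᵐ x, ‖f x - b (dyadicIndex N x)‖ ≤ T) : ‖f - stepLp N b‖ ≤ T := by
  rw [Lp.norm_def]
  refine ENNReal.toReal_le_of_le_ofReal hT ?_
  rw [eLpNorm_exponent_top]
  refine eLpNormEssSup_le_of_ae_bound ?_
  filter_upwards [h, Lp.coeFn_sub f (stepLp N b), (memLp_stepFunction N b).coeFn_toLp]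
    with x hx h1 h2
  rw [h1, Pi.sub_apply]
  rwa [← h2] at hx

lemma holderTerm_le_norm {d : ℕ} {r : ℝ} {q : ℝ≥0∞} (f : HolderSpace d r q)
    (e : Finset (Fin d)) {h : Fin d → ℝ} (hh : h ∈ Increments d) :
    holderTerm d r q (f.1 : Torus d → ℂ) e h ≤ ‖f‖ := by
  refine (le_csSup (f.2 e) ⟨h, hh, rfl⟩).trans ?_
  refine Finset.single_le_sum (f := fun e => sSup ((fun h =>
    holderTerm d r q (f.1 : Torus d → ℂ) e h) '' Increments d)) (fun e _ => ?_)
    (Finset.mem_univ e)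
  refine Real.sSup_nonneg ?_
  rintro _ ⟨h, -, rfl⟩
  exact mul_nonneg (Finset.prod_nonneg fun _ _ => by positivity) ENNReal.toReal_nonneg

lemma dK_le {A B : Type*} [Norm A] [NormedAddCommGroup B] [NormedSpace ℂ B] (T : A → B) {m : ℕ}
    (L : Submodule ℂ B) [FiniteDimensional ℂ L] (hL : Module.finrank ℂ L < m) {c : ℝ}
    (hc : 0 ≤ c) (h : ∀ a, ‖a‖ ≤ 1 → ∃ b ∈ L, ‖T a - b‖ ≤ c) : dK T m ≤ c := by
  refine (ciInf_le ⟨0, ?_⟩ ⟨L, inferInstance, hL⟩).trans (Real.iSup_le (fun a => ?_) hc)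
  · rintro _ ⟨L, rfl⟩
    exact Real.iSup_nonneg fun _ => Real.iInf_nonneg fun _ => norm_nonneg _
  · obtain ⟨b, hb, hab⟩ := h a.1 a.2
    refine (ciInf_le ⟨0, ?_⟩ ⟨b, hb⟩).trans hab
    rintro _ ⟨b, rfl⟩
    exact norm_nonneg _

theorem stmt19 (d : ℕ) (hd : 1 ≤ d) (q : ℝ≥0∞) (hq : 2 < q) (r : ℝ)
    (hrp : (q⁻¹).toReal < r) (hr : r < 1 / 2) :
    ∃ C : ℝ, 0 < C ∧ ∀ m : ℕ, 2 ≤ m →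
      dK (fun f : HolderSpace d r q =>
          (f.1 : Lp ℂ ∞ (volume : Measure (Torus d)))) m ≤
        C * (m : ℝ) ^ (-r) * Real.log m ^ ((d : ℝ) - 1 + r) := by
  have hr0 : 0 < r := ENNReal.toReal_nonneg.trans_lt hrp
  obtain ⟨p, hp, hrp', hpq⟩ := exists_real_exponent hq hrp
  obtain ⟨C₀, hC₀, hdecay⟩ := exists_hasHaarDecay d (by linarith) hpq hr0
  obtain ⟨d, rfl⟩ := Nat.exists_eq_add_of_le' hd
  obtain ⟨C, hC, happ⟩ := exists_subspace_haarDecay d hp hrp' hr hC₀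
  refine ⟨C, hC, fun m hm => ?_⟩
  obtain ⟨N, W, hW, hWb⟩ := happ m hm
  have hlog : 0 ≤ log m := log_natCast_nonneg m
  have hexp : ((d + 1 : ℕ) : ℝ) - 1 + r = d + r := by push_cast; ring
  rw [hexp, mul_assoc]
  refine dK_le _ (W.map (stepLp N)) ((Submodule.finrank_map_le _ _).trans_lt hW)
    (by positivity) fun f hf => ?_
  obtain ⟨b, hb, hfb⟩ := hWb (f.1 : Torus (d + 1) → ℂ) <| hdecay _ (Lp.memLp f.1)
    fun e h hh => (holderTerm_le_norm f e hh).trans hf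
  exact ⟨_, Submodule.mem_map_of_mem hb, norm_sub_stepLp_le f.1 b (by positivity) hfb⟩

end
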